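/- arXiv:1301.2492 — 2 statements merged into one kernel-verified Lean document; each statement's English description precedes it below -/
import Mathlib

section
/- Gluing Lemma (local coordinate form). Let (h1, L1) be a compatible pair on an open set U1 ⊆ ℝ^m and (h2, L2) a compatible pair on an open set U2 ⊆ ℝ^k. Assume that for every x ∈ U1 and y ∈ U2 the matrices L1(x) and L2(y) have no common complex eigenvalue. For (x,y) ∈ U1 × U2 let χ_{2,y}(t) := det(t·I_k − L2(y)) and χ_{1,x}(t) := det(t·I_m − L1(x)), and define on U1 × U2 ⊆ ℝ^{m+k} the block-diagonal matrices L(x,y) := blockdiag(L1(x), L2(y)) and g(x,y) := blockdiag( h1(x)·χ_{2,y}(L1(x)), h2(y)·χ_{1,x}(L2(y)) ), where χ(A) denotes evaluation of the polynomial χ on the matrix A. Then g(x,y) is symmetric and invertible, L(x,y) is invertible, g(x,y)L(x,y) is symmetric, and L is compatible with g on U1 × U2. -/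
open Matrix Polynomial

noncomputable def pd {ι : Type*} [Fintype ι] [DecidableEq ι] (i : ι)
    (f : (ι → ℝ) → ℝ) (x : ι → ℝ) : ℝ :=
  fderiv ℝ f x (Pi.single i 1)

noncomputable def christoffel {ι : Type*} [Fintype ι] [DecidableEq ι]
    (g : (ι → ℝ) → Matrix ι ι ℝ) (x : ι → ℝ) (l j k : ι) : ℝ :=
  (1/2) * ∑ m, (g x)⁻¹ l m *
    (pd j (fun y => g y m k) x + pd k (fun y => g y m j) x - pd m (fun y => g y j k) x)

def IsCompatiblePair {ι : Type*} [Fintype ι] [DecidableEq ι]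
    (U : Set (ι → ℝ)) (g L : (ι → ℝ) → Matrix ι ι ℝ) : Prop :=
  (∀ i j : ι, ContDiffOn ℝ (⊤ : ℕ∞) (fun y => g y i j) U) ∧
  (∀ i j : ι, ContDiffOn ℝ (⊤ : ℕ∞) (fun y => L y i j) U) ∧
  (∀ x ∈ U, (g x).IsSymm ∧ IsUnit (g x).det ∧ IsUnit (L x).det ∧ (g x * L x).IsSymm) ∧
  (∀ x ∈ U, ∀ i j k : ι,
    pd k (fun y => (g y * L y) i j) x
      - (∑ l, christoffel g x l k i * (g x * L x) l j)
      - (∑ l, christoffel g x l k j * (g x * L x) i l)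
    = pd i (fun y => (1/2) * (L y).trace) x * g x j k
      + pd j (fun y => (1/2) * (L y).trace) x * g x i k)


section AlgebraPart

set_option linter.unusedSectionVars false

variable {ι : Type*} [Fintype ι] [DecidableEq ι]

/-- lowered Christoffel symbols of formal derivative data -/
noncomputable def lowC (dg : ι → Matrix ι ι ℝ) (k : ι) : Matrix ι ι ℝ :=
  Matrix.of fun m j => (1/2) * (dg k m j + dg j m k - dg m k j)

/-- inverse-free form of the compatibility equation at a point -/
def AlgCompat (g : Matrix ι ι ℝ) (dg : ι → Matrix ι ι ℝ) (L : Matrix ι ι ℝ)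
    (dL : ι → Matrix ι ι ℝ) (lam : ι → ℝ) : Prop :=
  ∀ k, g * dL k + lowC dg k * L - Lᵀ * lowC dg k
    = vecMulVec lam (g k) + vecMulVec (g k) lam

lemma lowC_symm {dg : ι → Matrix ι ι ℝ} (hdg : ∀ k, (dg k).IsSymm) (m j k : ι) :
    lowC dg k m j = lowC dg j m k := by
  have := (hdg m).apply j k
  simp only [lowC, Matrix.of_apply]
  rw [this]; ring

lemma dg_eq_lowC {dg : ι → Matrix ι ι ℝ} (hdg : ∀ k, (dg k).IsSymm) (k : ι) :
    dg k = lowC dg k + (lowC dg k)ᵀ := by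
  ext i j
  have h1 := (hdg k).apply i j
  have h2 := (hdg i).apply j k
  have h3 := (hdg j).apply i k
  simp only [lowC, Matrix.of_apply, Matrix.add_apply, Matrix.transpose_apply]
  linarith

lemma dgL_formula {g : Matrix ι ι ℝ} {dg : ι → Matrix ι ι ℝ} {L : Matrix ι ι ℝ}
    {dL : ι → Matrix ι ι ℝ} {lam : ι → ℝ} (hdg : ∀ k, (dg k).IsSymm)
    (H : AlgCompat g dg L dL lam) (k : ι) :
    dg k * L + g * dL k = (lowC dg k)ᵀ * L + Lᵀ * lowC dg k
      + (vecMulVec lam (g k) + vecMulVec (g k) lam) := by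
  rw [← H k]
  conv_lhs => rw [dg_eq_lowC hdg k]
  rw [add_mul]; abel

lemma dgL_symm {g : Matrix ι ι ℝ} {dg : ι → Matrix ι ι ℝ} {L : Matrix ι ι ℝ}
    {dL : ι → Matrix ι ι ℝ} {lam : ι → ℝ} (hdg : ∀ k, (dg k).IsSymm)
    (H : AlgCompat g dg L dL lam) (k : ι) :
    (dg k * L + g * dL k).IsSymm := by
  rw [dgL_formula hdg H k, Matrix.IsSymm]
  simp only [Matrix.transpose_add, Matrix.transpose_mul, Matrix.transpose_transpose,
    Matrix.transpose_vecMulVec]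
  abel

lemma lowC_gL {g : Matrix ι ι ℝ} {dg : ι → Matrix ι ι ℝ} {L : Matrix ι ι ℝ}
    {dL : ι → Matrix ι ι ℝ} {lam : ι → ℝ} (hg : g.IsSymm) (hdg : ∀ k, (dg k).IsSymm)
    (H : AlgCompat g dg L dL lam) (k : ι) :
    lowC (fun k => dg k * L + g * dL k) k = Lᵀ * lowC dg k + vecMulVec lam (g k) := by
  have key : ∀ k i j, (dg k * L + g * dL k) i j
      = ((lowC dg k)ᵀ * L) i j + ((lowC dg k)ᵀ * L) j i + (lam i * g k j + g k i * lam j) := by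
    intro k i j
    rw [dgL_formula hdg H k]
    have : Lᵀ * lowC dg k = ((lowC dg k)ᵀ * L)ᵀ := by
      rw [Matrix.transpose_mul, Matrix.transpose_transpose]
    rw [this]
    simp only [Matrix.add_apply, vecMulVec_apply, Matrix.transpose_apply]
  have hS : ∀ k i j, ((lowC dg k)ᵀ * L) i j = ((lowC dg i)ᵀ * L) k j := by
    intro k i j
    simp only [Matrix.mul_apply, Matrix.transpose_apply]
    exact Finset.sum_congr rfl fun a _ => by rw [lowC_symm hdg a i k]
  ext m j
  have e : (Lᵀ * lowC dg k) m j = ((lowC dg k)ᵀ * L) j m := by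
    have : Lᵀ * lowC dg k = ((lowC dg k)ᵀ * L)ᵀ := by
      rw [Matrix.transpose_mul, Matrix.transpose_transpose]
    rw [this]; rfl
  rw [Matrix.add_apply, e, lowC, Matrix.of_apply, key, key, key, vecMulVec_apply,
    hS j m k, hS j k m, hS m k j]
  have a1 := hg.apply j k
  have a2 := hg.apply m k
  have a3 := hg.apply m j
  rw [hg.apply j k, hg.apply m k, hg.apply m j]
  ring

lemma AlgCompat.step {g : Matrix ι ι ℝ} {dg : ι → Matrix ι ι ℝ} {L : Matrix ι ι ℝ}
    {dL : ι → Matrix ι ι ℝ} {lam : ι → ℝ} (hg : g.IsSymm) (hdg : ∀ k, (dg k).IsSymm)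
    (hgL : (g * L).IsSymm) (H : AlgCompat g dg L dL lam) :
    AlgCompat (g * L) (fun k => dg k * L + g * dL k) L dL lam := by
  intro k
  rw [lowC_gL hg hdg H k]
  have hT : g * L = Lᵀ * g := by
    have := hgL; rw [Matrix.IsSymm, Matrix.transpose_mul, hg] at this; exact this.symm
  have e1 : (g * L) k = g k ᵥ* L := by
    ext j; simp [Matrix.mul_apply, vecMul, dotProduct]
  have e2 : (g * L) k = Lᵀ *ᵥ g k := by
    rw [e1, Matrix.mulVec_transpose]
  have hk := H k
  have : g * L * dL k + (Lᵀ * lowC dg k + vecMulVec lam (g k)) * L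
      - Lᵀ * (Lᵀ * lowC dg k + vecMulVec lam (g k))
      = Lᵀ * (g * dL k + lowC dg k * L - Lᵀ * lowC dg k)
        + vecMulVec lam (g k) * L - Lᵀ * vecMulVec lam (g k) := by
    rw [hT]; noncomm_ring
  rw [this, hk, Matrix.mul_add, Matrix.mul_vecMulVec, Matrix.mul_vecMulVec, Matrix.vecMulVec_mul,
    ← e1, ← e2]
  abel

lemma AlgCompat.sum {α : Type*} (s : Finset α) (c : α → ℝ) {g : α → Matrix ι ι ℝ}
    {dg : α → ι → Matrix ι ι ℝ} {L : Matrix ι ι ℝ}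
    {dL : ι → Matrix ι ι ℝ} {lam : ι → ℝ} (H : ∀ a, AlgCompat (g a) (dg a) L dL lam) :
    AlgCompat (∑ a ∈ s, c a • g a) (fun k => ∑ a ∈ s, c a • dg a k) L dL lam := by
  classical
  intro k
  have hC : lowC (fun k => ∑ a ∈ s, c a • dg a k) k = ∑ a ∈ s, c a • lowC (dg a) k := by
    ext m j
    simp only [lowC, Matrix.of_apply, Matrix.sum_apply, Matrix.smul_apply, smul_eq_mul,
      Finset.mul_sum, ← Finset.sum_add_distrib, ← Finset.sum_sub_distrib]
    exact Finset.sum_congr rfl fun a _ => by ring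
  have hk : (∑ a ∈ s, c a • g a) k = ∑ a ∈ s, c a • g a k := by
    ext j; simp [Matrix.sum_apply]
  rw [hC, hk]
  have h2 : vecMulVec lam (∑ a ∈ s, c a • g a k) + vecMulVec (∑ a ∈ s, c a • g a k) lam
      = ∑ a ∈ s, c a • (vecMulVec lam (g a k) + vecMulVec (g a k) lam) := by
    ext i j
    simp only [Matrix.add_apply, vecMulVec_apply, Matrix.sum_apply, Matrix.smul_apply, smul_eq_mul,
      Finset.sum_apply, Pi.smul_apply, Finset.mul_sum, Finset.sum_mul, ← Finset.sum_add_distrib]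
    exact Finset.sum_congr rfl fun a _ => by ring
  rw [h2]
  simp only [Finset.sum_mul, Finset.mul_sum]
  rw [← Finset.sum_add_distrib, ← Finset.sum_sub_distrib]
  exact Finset.sum_congr rfl fun a _ => by
    rw [← H a k]
    simp only [Matrix.smul_mul, Matrix.mul_smul, smul_sub, smul_add]

/-- algebraic derivative of the characteristic polynomial -/
lemma alg_charpoly {h : Matrix ι ι ℝ} {dh : ι → Matrix ι ι ℝ} {L : Matrix ι ι ℝ}
    {dL : ι → Matrix ι ι ℝ} {lam : ι → ℝ} (hh : h.IsSymm) (hu : IsUnit h.det)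
    (hhL : (h * L).IsSymm) (H : AlgCompat h dh L dL lam) (t : ℝ) (k : ι) :
    (adjugate (scalar ι t - L) * dL k).trace = 2 * (lam ᵥ* adjugate (scalar ι t - L)) k := by
  set A := adjugate (scalar ι t - L) with hA
  have hT : h * L = Lᵀ * h := by
    have := hhL; rw [Matrix.IsSymm, Matrix.transpose_mul, hh] at this; exact this.symm
  have hi : h⁻¹ * h = 1 := Matrix.nonsing_inv_mul h hu
  have hi' : h * h⁻¹ = 1 := Matrix.mul_nonsing_inv h hu
  have hcomm : A * L = L * A := by
    have a1 := Matrix.adjugate_mul (scalar ι t - L)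
    have a2 := Matrix.mul_adjugate (scalar ι t - L)
    have : A * (scalar ι t - L) = (scalar ι t - L) * A := by rw [a1, a2]
    have hs : A * scalar ι t = scalar ι t * A := (scalar_commute t (fun r => mul_comm _ _) A).symm
    rw [mul_sub, sub_mul, hs] at this
    exact sub_right_injective this
  have hAT : h * A = Aᵀ * h := by
    have e : h * (scalar ι t - L) * h⁻¹ = (scalar ι t - L)ᵀ := by
      have hs : h * scalar ι t = scalar ι t * h :=
        (scalar_commute t (fun r => mul_comm _ _) h).symm
      rw [mul_sub, hs, hT, ← sub_mul, mul_assoc, hi', mul_one, Matrix.transpose_sub]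
      simp
    rw [hA, adjugate_transpose, ← e, Matrix.adjugate_mul_distrib, Matrix.adjugate_mul_distrib]
    have hd : adjugate h⁻¹ = (h⁻¹).det • h := by
      have := Matrix.adjugate_mul h⁻¹
      calc adjugate h⁻¹ = adjugate h⁻¹ * (h⁻¹ * h) := by rw [hi, mul_one]
        _ = _ := by rw [← mul_assoc, this]; simp
    have hd2 : h.adjugate * h = h.det • 1 := Matrix.adjugate_mul h
    rw [hd, Matrix.mul_assoc, Matrix.mul_assoc, hd2]
    have : (h⁻¹).det * h.det = 1 := by rw [← Matrix.det_mul, hi, Matrix.det_one]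
    rw [Matrix.mul_smul, Matrix.mul_smul, Matrix.smul_mul, smul_smul, mul_one, mul_comm h.det, this, one_smul]
  have e0 : dL k = h⁻¹ * (vecMulVec lam (h k) + vecMulVec (h k) lam)
      - (h⁻¹ * lowC dh k) * L + L * (h⁻¹ * lowC dh k) := by
    rw [← H k]
    have hL : L * h⁻¹ = h⁻¹ * Lᵀ := by
      calc L * h⁻¹ = h⁻¹ * h * L * h⁻¹ := by rw [hi, one_mul]
        _ = h⁻¹ * (h * L) * h⁻¹ := by simp only [mul_assoc]
        _ = _ := by rw [hT]; simp only [mul_assoc, hi', mul_one]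
    have : L * (h⁻¹ * lowC dh k) = h⁻¹ * Lᵀ * lowC dh k := by rw [← mul_assoc, hL]
    rw [this, mul_sub, mul_add, ← mul_assoc h⁻¹ h, hi]
    noncomm_ring
  have htr : (A * (-((h⁻¹ * lowC dh k) * L) + L * (h⁻¹ * lowC dh k))).trace = 0 := by
    rw [mul_add, Matrix.mul_neg, Matrix.trace_add, Matrix.trace_neg, ← mul_assoc A L, hcomm, mul_assoc L A,
      Matrix.trace_mul_comm L, mul_assoc, mul_assoc, mul_assoc, neg_add_cancel]
  have e1 : A * dL k = A * (h⁻¹ * (vecMulVec lam (h k) + vecMulVec (h k) lam))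
      + A * (-((h⁻¹ * lowC dh k) * L) + L * (h⁻¹ * lowC dh k)) := by
    rw [e0]; noncomm_ring
  rw [e1, Matrix.trace_add, htr, add_zero, mul_add, mul_add, Matrix.trace_add]
  have hrow : h k = Pi.single k 1 ᵥ* h := by ext j; simp
  have hcol : h k = h *ᵥ Pi.single k 1 := by rw [← Matrix.vecMul_transpose, hh, ← hrow]
  have t1 : (A * (h⁻¹ * vecMulVec lam (h k))).trace = (lam ᵥ* A) k := by
    rw [Matrix.mul_vecMulVec, Matrix.mul_vecMulVec, Matrix.trace_vecMulVec, dotProduct_comm, hrow,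
      ← Matrix.dotProduct_mulVec, Matrix.mulVec_mulVec, Matrix.mulVec_mulVec, hAT, mul_assoc Aᵀ, hi', mul_one,
      single_one_dotProduct, Matrix.mulVec_transpose]
  have t2 : (A * (h⁻¹ * vecMulVec (h k) lam)).trace = (lam ᵥ* A) k := by
    rw [Matrix.mul_vecMulVec, Matrix.mul_vecMulVec, Matrix.trace_vecMulVec, dotProduct_comm, hcol,
      Matrix.mulVec_mulVec, Matrix.mulVec_mulVec, mul_assoc A, hi, mul_one, Matrix.dotProduct_mulVec, dotProduct_single_one]
  rw [t1, t2]; ring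

lemma alg_charpoly_row {h : Matrix ι ι ℝ} {dh : ι → Matrix ι ι ℝ} {L : Matrix ι ι ℝ}
    {dL : ι → Matrix ι ι ℝ} {lam : ι → ℝ} (hh : h.IsSymm) (hu : IsUnit h.det)
    (hhL : (h * L).IsSymm) (H : AlgCompat h dh L dL lam) (t : ℝ) (b : ι) :
    ∑ k, (adjugate (scalar ι t - L) * dL k).trace * (scalar ι t - L) k b
      = 2 * (scalar ι t - L).det * lam b := by
  have : ∑ k, (adjugate (scalar ι t - L) * dL k).trace * (scalar ι t - L) k b
      = 2 * (lam ᵥ* adjugate (scalar ι t - L) ᵥ* (scalar ι t - L)) b := by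
    simp_rw [alg_charpoly hh hu hhL H t]
    rw [Matrix.vecMul, dotProduct, Finset.mul_sum]
    simp only [mul_assoc]
  rw [this, Matrix.vecMul_vecMul, Matrix.adjugate_mul]
  simp [Matrix.vecMul_smul]; ring

end AlgebraPart

section AnalysisPart

variable {ι : Type*} [Fintype ι] [DecidableEq ι]

lemma pd_mul {i : ι} {f g : (ι → ℝ) → ℝ} {x : ι → ℝ} (hf : DifferentiableAt ℝ f x)
    (hg : DifferentiableAt ℝ g x) :
    pd i (fun y => f y * g y) x = pd i f x * g x + f x * pd i g x := by
  unfold pd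
  rw [fderiv_fun_mul hf hg]
  simp; ring

lemma pd_add {i : ι} {f g : (ι → ℝ) → ℝ} {x : ι → ℝ} (hf : DifferentiableAt ℝ f x)
    (hg : DifferentiableAt ℝ g x) :
    pd i (fun y => f y + g y) x = pd i f x + pd i g x := by
  unfold pd
  rw [fderiv_fun_add hf hg]
  simp

lemma pd_const_mul {i : ι} {f : (ι → ℝ) → ℝ} {x : ι → ℝ} (hf : DifferentiableAt ℝ f x) (c : ℝ) :
    pd i (fun y => c * f y) x = c * pd i f x := by
  unfold pd
  rw [fderiv_const_mul hf]
  simp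

lemma pd_const_sub {i : ι} {f : (ι → ℝ) → ℝ} {x : ι → ℝ} (c : ℝ) :
    pd i (fun y => c - f y) x = - pd i f x := by
  unfold pd
  rw [fderiv_const_sub]
  simp

lemma pd_const {i : ι} {x : ι → ℝ} (c : ℝ) :
    pd i (fun _ => c) x = 0 := by
  unfold pd
  simp

lemma pd_sum {α : Type*} {s : Finset α} {i : ι} {f : α → (ι → ℝ) → ℝ} {x : ι → ℝ}
    (hf : ∀ a ∈ s, DifferentiableAt ℝ (f a) x) :
    pd i (fun y => ∑ a ∈ s, f a y) x = ∑ a ∈ s, pd i (f a) x := by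
  unfold pd
  rw [fderiv_fun_sum hf]
  simp

/-- entrywise partial derivative -/
noncomputable def matpd {α : Type*} (k : ι) (M : (ι → ℝ) → Matrix α α ℝ) (x : ι → ℝ) :
    Matrix α α ℝ :=
  Matrix.of fun i j => pd k (fun y => M y i j) x

lemma matpd_mul {α : Type*} [Fintype α] {k : ι} {M N : (ι → ℝ) → Matrix α α ℝ} {x : ι → ℝ}
    (hM : ∀ i j, DifferentiableAt ℝ (fun y => M y i j) x)
    (hN : ∀ i j, DifferentiableAt ℝ (fun y => N y i j) x) :
    matpd k (fun y => M y * N y) x = matpd k M x * N x + M x * matpd k N x := by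
  ext i j
  simp only [matpd, Matrix.of_apply, Matrix.add_apply, Matrix.mul_apply]
  rw [pd_sum fun a _ => (hM i a).fun_mul (hN a j), ← Finset.sum_add_distrib]
  exact Finset.sum_congr rfl fun a _ => pd_mul (hM i a) (hN a j)

lemma diff_mul {α E : Type*} [Fintype α] [NormedAddCommGroup E] [NormedSpace ℝ E]
    {M N : E → Matrix α α ℝ} {x : E}
    (hM : ∀ i j, DifferentiableAt ℝ (fun y => M y i j) x)
    (hN : ∀ i j, DifferentiableAt ℝ (fun y => N y i j) x) (i j : α) :
    DifferentiableAt ℝ (fun y => (M y * N y) i j) x := by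
  simp only [Matrix.mul_apply]
  exact DifferentiableAt.fun_sum fun a _ => (hM i a).mul (hN a j)

lemma contDiffOn_mul {α E : Type*} [Fintype α] [NormedAddCommGroup E] [NormedSpace ℝ E]
    {M N : E → Matrix α α ℝ} {s : Set E}
    (hM : ∀ i j, ContDiffOn ℝ (⊤ : ℕ∞) (fun y => M y i j) s)
    (hN : ∀ i j, ContDiffOn ℝ (⊤ : ℕ∞) (fun y => N y i j) s) (i j : α) :
    ContDiffOn ℝ (⊤ : ℕ∞) (fun y => (M y * N y) i j) s := by
  simp only [Matrix.mul_apply]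
  exact ContDiffOn.sum fun a _ => (hM i a).mul (hN a j)

lemma contDiffOn_pow {α E : Type*} [Fintype α] [DecidableEq α]
    [NormedAddCommGroup E] [NormedSpace ℝ E]
    {M : E → Matrix α α ℝ} {s : Set E}
    (hM : ∀ i j, ContDiffOn ℝ (⊤ : ℕ∞) (fun y => M y i j) s) (n : ℕ) (i j : α) :
    ContDiffOn ℝ (⊤ : ℕ∞) (fun y => (M y ^ n) i j) s := by
  induction n generalizing i j with
  | zero => simpa using contDiffOn_const
  | succ n ih => simp only [pow_succ]; exact contDiffOn_mul ih hM i j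

lemma contDiffOn_coeff_mul {E : Type*} [NormedAddCommGroup E] [NormedSpace ℝ E]
    {p q : E → ℝ[X]} {s : Set E}
    (hp : ∀ n, ContDiffOn ℝ (⊤ : ℕ∞) (fun y => (p y).coeff n) s)
    (hq : ∀ n, ContDiffOn ℝ (⊤ : ℕ∞) (fun y => (q y).coeff n) s) (n : ℕ) :
    ContDiffOn ℝ (⊤ : ℕ∞) (fun y => (p y * q y).coeff n) s := by
  simp only [Polynomial.coeff_mul]
  exact ContDiffOn.sum fun a _ => (hp _).mul (hq _)

lemma contDiffOn_coeff_prod {E α : Type*} [NormedAddCommGroup E] [NormedSpace ℝ E]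
    {p : α → E → ℝ[X]} {s : Set E} (t : Finset α)
    (hp : ∀ a n, ContDiffOn ℝ (⊤ : ℕ∞) (fun y => (p a y).coeff n) s) (n : ℕ) :
    ContDiffOn ℝ (⊤ : ℕ∞) (fun y => (∏ a ∈ t, p a y).coeff n) s := by
  classical
  induction t using Finset.induction_on generalizing n with
  | empty => simpa using contDiffOn_const
  | insert a t ha ih =>
    simp only [Finset.prod_insert ha]
    exact contDiffOn_coeff_mul (hp a) ih n

lemma contDiffOn_charpoly {E : Type*} [NormedAddCommGroup E] [NormedSpace ℝ E]
    {M : E → Matrix ι ι ℝ} {s : Set E}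
    (hM : ∀ i j, ContDiffOn ℝ (⊤ : ℕ∞) (fun y => M y i j) s) (n : ℕ) :
    ContDiffOn ℝ (⊤ : ℕ∞) (fun y => (M y).charpoly.coeff n) s := by
  simp only [Matrix.charpoly, Matrix.det_apply', Polynomial.finsetSum_coeff]
  refine ContDiffOn.sum fun σ _ => ?_
  have : ∀ y, ((((Equiv.Perm.sign σ : ℤˣ) : ℤ) : ℝ[X]) * ∏ i, charmatrix (M y) (σ i) i).coeff n
      = (((Equiv.Perm.sign σ : ℤˣ) : ℤ) : ℝ) * (∏ i, charmatrix (M y) (σ i) i).coeff n := by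
    intro y
    rw [← Polynomial.C_eq_intCast, Polynomial.coeff_C_mul]
  simp only [this]
  refine contDiffOn_const.mul (contDiffOn_coeff_prod _ (fun i n => ?_) n)
  simp only [charmatrix_apply, Polynomial.coeff_sub, Polynomial.coeff_C]
  refine contDiffOn_const.sub ?_
  split_ifs
  · exact hM _ _
  · exact contDiffOn_const

/-- Jacobi formula for the derivative of the determinant -/
lemma pd_det {κ : Type*} [Fintype κ] [DecidableEq κ] {k : ι} {M : (ι → ℝ) → Matrix κ κ ℝ}
    {x : ι → ℝ} (hM : ∀ i j, DifferentiableAt ℝ (fun y => M y i j) x) :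
    pd k (fun y => (M y).det) x = (adjugate (M x) * matpd k M x).trace := by
  have e : (adjugate (M x) * matpd k M x).trace
      = ∑ i, ((M x).updateCol i (fun a => matpd k M x a i)).det := by
    refine Finset.sum_congr rfl fun i _ => ?_
    rw [← Matrix.cramer_apply, Matrix.cramer_eq_adjugate_mulVec]
    rfl
  rw [e]
  simp only [Matrix.det_apply']
  rw [pd_sum, Finset.sum_comm]
  · refine Finset.sum_congr rfl fun σ _ => ?_
    rw [pd_const_mul, ← Finset.mul_sum]
    · congr 1
      unfold pd
      rw [(HasFDerivAt.finsetProd fun i _ => (hM (σ i) i).hasFDerivAt).fderiv]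
      rw [_root_.sum_apply]
      refine Finset.sum_congr rfl fun i _ => ?_
      rw [← Finset.mul_prod_erase _ _ (Finset.mem_univ i), _root_.smul_apply,
        smul_eq_mul, mul_comm]
      congr 1
      · simp [matpd, pd]
      · refine Finset.prod_congr rfl fun j hj => ?_
        rw [Matrix.updateCol_ne (Finset.ne_of_mem_erase hj)]
    · exact HasFDerivAt.differentiableAt (HasFDerivAt.finsetProd fun i _ => (hM (σ i) i).hasFDerivAt)
  · intro σ _
    exact (HasFDerivAt.differentiableAt (HasFDerivAt.finsetProd fun i _ => (hM (σ i) i).hasFDerivAt)).const_mul _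

lemma compat_iff {g L : (ι → ℝ) → Matrix ι ι ℝ} {x : ι → ℝ}
    (hg : ∀ i j, DifferentiableAt ℝ (fun y => g y i j) x)
    (hL : ∀ i j, DifferentiableAt ℝ (fun y => L y i j) x)
    (hs : (g x).IsSymm) (hu : IsUnit (g x).det) (hgL : (g x * L x).IsSymm)
    (hdg : ∀ k, (matpd k g x).IsSymm) (lam : ι → ℝ) :
    (∀ i j k : ι,
    pd k (fun y => (g y * L y) i j) x
      - (∑ l, christoffel g x l k i * (g x * L x) l j)
      - (∑ l, christoffel g x l k j * (g x * L x) i l)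
    = lam i * g x j k + lam j * g x i k) ↔
    AlgCompat (g x) (fun k => matpd k g x) (L x) (fun k => matpd k L x) lam := by
  set C := lowC (fun k => matpd k g x) with hC
  have hi : (g x)⁻¹ * g x = 1 := Matrix.nonsing_inv_mul _ hu
  have hi' : g x * (g x)⁻¹ = 1 := Matrix.mul_nonsing_inv _ hu
  have hT : g x * L x = (L x)ᵀ * g x := by
    have := hgL; rw [Matrix.IsSymm, Matrix.transpose_mul, hs] at this; exact this.symm
  have hch : ∀ l k i, christoffel g x l k i = ((g x)⁻¹ * C k) l i := by
    intro l k i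
    rw [christoffel, Matrix.mul_apply, Finset.mul_sum]
    refine Finset.sum_congr rfl fun m _ => ?_
    simp only [hC, lowC, matpd, Matrix.of_apply]
    ring
  have h1 : ∀ k i j, (∑ l, christoffel g x l k i * (g x * L x) l j) = ((C k)ᵀ * L x) i j := by
    intro k i j
    have : (C k)ᵀ * L x = ((g x)⁻¹ * C k)ᵀ * (g x * L x) := by
      rw [Matrix.transpose_mul, Matrix.transpose_nonsing_inv, hs, mul_assoc, ← mul_assoc _ (g x),
        hi, one_mul]
    rw [this, Matrix.mul_apply]
    simp only [hch, Matrix.transpose_apply]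
  have h2 : ∀ k i j, (∑ l, christoffel g x l k j * (g x * L x) i l) = ((L x)ᵀ * C k) i j := by
    intro k i j
    have : (L x)ᵀ * C k = (g x * L x) * ((g x)⁻¹ * C k) := by
      rw [hT, mul_assoc, ← mul_assoc (g x), hi', one_mul]
    rw [this, Matrix.mul_apply]
    exact Finset.sum_congr rfl fun a _ => by rw [hch, mul_comm]
  have h3 : ∀ k i j, pd k (fun y => (g y * L y) i j) x
      = (C k * L x + (C k)ᵀ * L x + g x * matpd k L x) i j := by
    intro k i j
    rw [← add_mul, ← dg_eq_lowC hdg k, ← matpd_mul hg hL]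
    rfl
  have key : ∀ i j k, (pd k (fun y => (g y * L y) i j) x
      - (∑ l, christoffel g x l k i * (g x * L x) l j)
      - (∑ l, christoffel g x l k j * (g x * L x) i l)
    = lam i * g x j k + lam j * g x i k) ↔
     (g x * matpd k L x + C k * L x - (L x)ᵀ * C k) i j
       = (vecMulVec lam (g x k) + vecMulVec (g x k) lam) i j := by
    intro i j k
    rw [h1, h2, h3]
    simp only [Matrix.add_apply, Matrix.sub_apply, vecMulVec_apply]
    rw [hs.apply k j, hs.apply k i, mul_comm (lam j)]
    constructor <;> intro h <;> linarith
  constructor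
  · intro h k
    ext i j
    exact (key i j k).1 (h i j k)
  · intro h i j k
    exact (key i j k).2 (by rw [h k])

lemma hpow_symm {h L : Matrix ι ι ℝ} (hh : h.IsSymm) (hL : (h * L).IsSymm) (n : ℕ) :
    (h * L ^ n).IsSymm := by
  have hT : Lᵀ * h = h * L := by
    have := hL; rwa [Matrix.IsSymm, Matrix.transpose_mul, hh] at this
  induction n with
  | zero => simpa using hh
  | succ n ih =>
    rw [Matrix.IsSymm, Matrix.transpose_mul, hh] at ih ⊢
    rw [pow_succ', Matrix.transpose_mul, mul_assoc, hT, ← mul_assoc, ih, mul_assoc, ← pow_succ,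
      ← pow_succ']

lemma pow_compat {h L : (ι → ℝ) → Matrix ι ι ℝ} {x : ι → ℝ} {lam : ι → ℝ}
    (hg : ∀ i j, DifferentiableAt ℝ (fun y => h y i j) x)
    (hL : ∀ i j, DifferentiableAt ℝ (fun y => L y i j) x)
    (hs : (h x).IsSymm) (hgL : (h x * L x).IsSymm)
    (hdg : ∀ k, (matpd k h x).IsSymm)
    (H : AlgCompat (h x) (fun k => matpd k h x) (L x) (fun k => matpd k L x) lam) (n : ℕ) :
    (∀ i j, DifferentiableAt ℝ (fun y => (h y * L y ^ n) i j) x) ∧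
    (∀ k, (matpd k (fun y => h y * L y ^ n) x).IsSymm) ∧
    AlgCompat (h x * L x ^ n) (fun k => matpd k (fun y => h y * L y ^ n) x) (L x)
      (fun k => matpd k L x) lam := by
  induction n with
  | zero => simpa using ⟨hg, hdg, H⟩
  | succ n ih =>
    obtain ⟨i1, i2, i3⟩ := ih
    have e : ∀ y, h y * L y ^ (n+1) = (h y * L y ^ n) * L y := by
      intro y; rw [pow_succ, mul_assoc]
    simp only [e]
    have e2 : ∀ k, matpd k (fun y => h y * L y ^ n * L y) x
        = matpd k (fun y => h y * L y ^ n) x * L x + (h x * L x ^ n) * matpd k L x :=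
      fun k => matpd_mul i1 hL
    refine ⟨diff_mul i1 hL, ?_, ?_⟩
    · intro k
      rw [e2]
      exact dgL_symm i2 i3 k
    · simp only [e2]
      refine AlgCompat.step (hpow_symm hs hgL n) i2 ?_ i3
      rw [← e]
      exact hpow_symm hs hgL (n+1)

/-- derivative of the characteristic polynomial, coefficientwise -/
noncomputable def dchi (k : ι) (L : (ι → ℝ) → Matrix ι ι ℝ) (x : ι → ℝ) : ℝ[X] :=
  ∑ n ∈ Finset.range (Fintype.card ι + 1),
    Polynomial.C (pd k (fun y => (L y).charpoly.coeff n) x) * Polynomial.X ^ n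

lemma charpoly_sum (L : Matrix ι ι ℝ) (t : ℝ) : (L.charpoly).eval t
    = ∑ n ∈ Finset.range (Fintype.card ι + 1), L.charpoly.coeff n * t ^ n := by
  rw [Polynomial.eval_eq_sum_range, Matrix.charpoly_natDegree_eq_dim]

lemma dchi_eval {L : (ι → ℝ) → Matrix ι ι ℝ} {x : ι → ℝ}
    (hL : ∀ i j, DifferentiableAt ℝ (fun y => L y i j) x)
    (hc : ∀ n, DifferentiableAt ℝ (fun y => (L y).charpoly.coeff n) x) (k : ι) (t : ℝ) :
    (dchi k L x).eval t = - (adjugate (scalar ι t - L x) * matpd k L x).trace := by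
  have e1 : (dchi k L x).eval t = pd k (fun y => (L y).charpoly.eval t) x := by
    simp only [charpoly_sum]
    rw [pd_sum fun n _ => (hc n).mul_const _, dchi, Polynomial.eval_finsetSum]
    refine Finset.sum_congr rfl fun n _ => ?_
    rw [pd_mul (hc n) (differentiableAt_const _), pd_const]
    simp
  rw [e1]
  simp only [Matrix.eval_charpoly]
  rw [pd_det]
  · have : matpd k (fun y => scalar ι t - L y) x = - matpd k L x := by
      ext i j
      simp only [matpd, Matrix.of_apply, Matrix.sub_apply, Matrix.neg_apply]
      exact pd_const_sub _
    rw [this, Matrix.mul_neg, Matrix.trace_neg]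
  · intro i j
    simp only [Matrix.sub_apply]
    exact (hL i j).const_sub _

lemma dchi_row {h L : (ι → ℝ) → Matrix ι ι ℝ} {x : ι → ℝ} {lam : ι → ℝ}
    (hL : ∀ i j, DifferentiableAt ℝ (fun y => L y i j) x)
    (hc : ∀ n, DifferentiableAt ℝ (fun y => (L y).charpoly.coeff n) x)
    (hs : (h x).IsSymm) (hu : IsUnit (h x).det) (hgL : (h x * L x).IsSymm)
    (H : AlgCompat (h x) (fun k => matpd k h x) (L x) (fun k => matpd k L x) lam) (b : ι) :
    ∑ k, Polynomial.C (L x k b) * dchi k L x - Polynomial.X * dchi b L x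
      = Polynomial.C (2 * lam b) * (L x).charpoly := by
  refine Polynomial.funext fun t => ?_
  have := alg_charpoly_row hs hu hgL H t b
  simp only [Polynomial.eval_sub, Polynomial.eval_finsetSum, Polynomial.eval_mul,
    Polynomial.eval_C, Polynomial.eval_X, dchi_eval hL hc, Matrix.eval_charpoly]
  simp only [Matrix.sub_apply, mul_sub, Finset.sum_sub_distrib, Matrix.scalar_apply,
    Matrix.diagonal_apply, mul_ite, mul_zero, Finset.sum_ite_eq', Finset.mem_univ, if_true] at this ⊢
  simp only [mul_neg, Finset.sum_neg_distrib]
  have e : ∑ k, L x k b * (((Matrix.diagonal fun _ => t) - L x).adjugate * matpd k L x).trace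
    = ∑ k, (((Matrix.diagonal fun _ => t) - L x).adjugate * matpd k L x).trace * L x k b :=
    Finset.sum_congr rfl fun _ _ => mul_comm _ _
  linarith

end AnalysisPart

section GluingPart

set_option linter.unusedSectionVars false

variable {ι κ : Type*} [Fintype ι] [DecidableEq ι] [Fintype κ] [DecidableEq κ]

lemma diffAt_of_contDiffOn {E : Type*} [NormedAddCommGroup E] [NormedSpace ℝ E]
    {f : E → ℝ} {U : Set E} (hU : IsOpen U)
    (hf : ContDiffOn ℝ (⊤ : ℕ∞) f U) {x : E} (hx : x ∈ U) : DifferentiableAt ℝ f x :=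
  (hf.contDiffAt (hU.mem_nhds hx)).differentiableAt (by simp)

lemma matpd_symm {U : Set (ι → ℝ)} (hU : IsOpen U) {h : (ι → ℝ) → Matrix κ κ ℝ}
    (hs : ∀ x ∈ U, (h x).IsSymm) {x : ι → ℝ} (hx : x ∈ U) (k : ι) :
    (matpd k h x).IsSymm := by
  refine Matrix.IsSymm.ext fun i j => ?_
  simp only [matpd, Matrix.of_apply, pd]
  have : (fun y => h y j i) =ᶠ[nhds x] (fun y => h y i j) := by
    filter_upwards [hU.mem_nhds hx] with y hy
    exact (hs y hy).apply i j
  rw [this.fderiv_eq]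

/-- half trace derivative -/
noncomputable def lamOf (L : (ι → ℝ) → Matrix ι ι ℝ) (x : ι → ℝ) : ι → ℝ :=
  fun i => pd i (fun y => (1/2) * (L y).trace) x

lemma IsCompatiblePair.alg {U : Set (ι → ℝ)} (hU : IsOpen U) {h L : (ι → ℝ) → Matrix ι ι ℝ}
    (H : IsCompatiblePair U h L) {x : ι → ℝ} (hx : x ∈ U) :
    AlgCompat (h x) (fun k => matpd k h x) (L x) (fun k => matpd k L x) (lamOf L x) := by
  obtain ⟨a, b, c, d⟩ := H
  obtain ⟨c1, c2, c3, c4⟩ := c x hx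
  exact (compat_iff (fun i j => diffAt_of_contDiffOn hU (a i j) hx)
    (fun i j => diffAt_of_contDiffOn hU (b i j) hx) c1 c2 c4
    (matpd_symm hU (fun y hy => (c y hy).1) hx) _).1 (d x hx)

lemma aeval_charpoly_sum (h L : Matrix ι ι ℝ) (N : Matrix κ κ ℝ) :
    h * Polynomial.aeval L N.charpoly
      = ∑ n ∈ Finset.range (Fintype.card κ + 1), N.charpoly.coeff n • (h * L ^ n) := by
  rw [Polynomial.aeval_eq_sum_range, Matrix.charpoly_natDegree_eq_dim, Finset.mul_sum]
  simp only [Matrix.mul_smul]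

lemma aeval_dchi (h L : Matrix ι ι ℝ) (N : (κ → ℝ) → Matrix κ κ ℝ) (y : κ → ℝ) (c : κ) :
    h * Polynomial.aeval L (dchi c N y)
      = ∑ n ∈ Finset.range (Fintype.card κ + 1),
        pd c (fun y => (N y).charpoly.coeff n) y • (h * L ^ n) := by
  rw [dchi, map_sum, Finset.mul_sum]
  refine Finset.sum_congr rfl fun n _ => ?_
  rw [map_mul, map_pow, Polynomial.aeval_X, Polynomial.aeval_C, Algebra.algebraMap_eq_smul_one,
    Matrix.smul_mul, one_mul, Matrix.mul_smul]

lemma aeval_symm {h L : Matrix ι ι ℝ} (hh : h.IsSymm) (hL : (h * L).IsSymm) (p : ℝ[X]) :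
    (h * Polynomial.aeval L p).IsSymm := by
  rw [Polynomial.aeval_eq_sum_range, Finset.mul_sum, Matrix.IsSymm, Matrix.transpose_sum]
  refine Finset.sum_congr rfl fun n _ => ?_
  rw [Matrix.mul_smul, Matrix.transpose_smul, hpow_symm hh hL n]

lemma aeval_comm {h L : Matrix ι ι ℝ} (hh : h.IsSymm) (hL : (h * L).IsSymm) (p : ℝ[X]) :
    Lᵀ * (h * Polynomial.aeval L p) = h * Polynomial.aeval L p * L ∧
    Lᵀ * (h * Polynomial.aeval L p) = h * Polynomial.aeval L (Polynomial.X * p) := by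
  have hT : Lᵀ * h = h * L := by
    have := hL; rwa [Matrix.IsSymm, Matrix.transpose_mul, hh] at this
  have e : Lᵀ * (h * Polynomial.aeval L p) = h * Polynomial.aeval L (Polynomial.X * p) := by
    rw [← mul_assoc, hT, map_mul, Polynomial.aeval_X, mul_assoc]
  refine ⟨?_, e⟩
  rw [e, mul_comm, map_mul, Polynomial.aeval_X, mul_assoc]

lemma lowC_blocks_inl (dG1 : ι → Matrix ι ι ℝ) (eG1 : κ → Matrix ι ι ℝ)
    (dG2 : κ → Matrix κ κ ℝ) (eG2 : ι → Matrix κ κ ℝ) (c : ι) :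
    lowC (Sum.elim (fun c => fromBlocks (dG1 c) 0 0 (eG2 c))
      (fun γ => fromBlocks (eG1 γ) 0 0 (dG2 γ))) (Sum.inl c)
    = fromBlocks (lowC dG1 c) (Matrix.of fun a β => (1/2) * eG1 β a c)
      (Matrix.of fun α b => -(1/2) * eG1 α c b) ((1/2 : ℝ) • eG2 c) := by
  ext i j
  rcases i with i | i <;> rcases j with j | j <;> simp [lowC]

lemma lowC_blocks_inr (dG1 : ι → Matrix ι ι ℝ) (eG1 : κ → Matrix ι ι ℝ)
    (dG2 : κ → Matrix κ κ ℝ) (eG2 : ι → Matrix κ κ ℝ) (c : κ) :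
    lowC (Sum.elim (fun c => fromBlocks (dG1 c) 0 0 (eG2 c))
      (fun γ => fromBlocks (eG1 γ) 0 0 (dG2 γ))) (Sum.inr c)
    = fromBlocks ((1/2 : ℝ) • eG1 c) (Matrix.of fun a β => -(1/2) * eG2 a c β)
      (Matrix.of fun α b => (1/2) * eG2 b α c) (lowC dG2 c) := by
  ext i j
  rcases i with i | i <;> rcases j with j | j <;> simp [lowC]

lemma glue_alg {G1 L1 : Matrix ι ι ℝ} {G2 L2 : Matrix κ κ ℝ}
    {dG1 dL1 : ι → Matrix ι ι ℝ} {eG1 : κ → Matrix ι ι ℝ}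
    {dG2 dL2 : κ → Matrix κ κ ℝ} {eG2 : ι → Matrix κ κ ℝ} {lam1 : ι → ℝ} {lam2 : κ → ℝ}
    (H1 : AlgCompat G1 dG1 L1 dL1 lam1) (H2 : AlgCompat G2 dG2 L2 dL2 lam2)
    (hG1 : G1.IsSymm) (hG2 : G2.IsSymm)
    (c1 : ∀ γ, L1ᵀ * eG1 γ = eG1 γ * L1) (c2 : ∀ γ, L2ᵀ * eG2 γ = eG2 γ * L2)
    (r1 : ∀ β, ∑ μ, L2 μ β • eG1 μ - L1ᵀ * eG1 β = (2 * lam2 β) • G1)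
    (r2 : ∀ β, ∑ μ, L1 μ β • eG2 μ - L2ᵀ * eG2 β = (2 * lam1 β) • G2) :
    AlgCompat (fromBlocks G1 0 0 G2)
      (Sum.elim (fun c => fromBlocks (dG1 c) 0 0 (eG2 c))
        (fun γ => fromBlocks (eG1 γ) 0 0 (dG2 γ)))
      (fromBlocks L1 0 0 L2)
      (Sum.elim (fun c => fromBlocks (dL1 c) 0 0 0) (fun γ => fromBlocks 0 0 0 (dL2 γ)))
      (Sum.elim lam1 lam2) := by
  have hr1 : ∀ β a c, ∑ μ, L2 μ β * eG1 μ a c - (L1ᵀ * eG1 β) a c = 2 * lam2 β * G1 a c := by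
    intro β a c
    have := congrFun (congrFun (r1 β) a) c
    simpa [Matrix.sub_apply, Matrix.sum_apply] using this
  have hr2 : ∀ β a c, ∑ μ, L1 μ β * eG2 μ a c - (L2ᵀ * eG2 β) a c = 2 * lam1 β * G2 a c := by
    intro β a c
    have := congrFun (congrFun (r2 β) a) c
    simpa [Matrix.sub_apply, Matrix.sum_apply] using this
  rintro (c | c)
  · rw [lowC_blocks_inl]
    simp only [Sum.elim_inl, fromBlocks_multiply, fromBlocks_transpose, fromBlocks_add,
      Matrix.transpose_zero, Matrix.mul_zero, Matrix.zero_mul, add_zero, zero_add]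
    have hH := H1 c
    ext i j
    rcases i with i | i <;> rcases j with j | j
    · have := congrFun (congrFun hH i) j
      simpa [vecMulVec_apply] using this
    · have := hr1 j i c
      have e1 : ∑ μ, 1 / 2 * eG1 μ i c * L2 μ j = 1/2 * ∑ μ, L2 μ j * eG1 μ i c := by
        rw [Finset.mul_sum]; exact Finset.sum_congr rfl fun _ _ => by ring
      have e2 : ∑ a, L1 a i * (1 / 2 * eG1 j a c) = 1/2 * (L1ᵀ * eG1 j) i c := by
        rw [Matrix.mul_apply, Finset.mul_sum]
        exact Finset.sum_congr rfl fun _ _ => by rw [Matrix.transpose_apply]; ring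
      simp only [Matrix.sub_apply, Matrix.add_apply, fromBlocks_apply₁₂, vecMulVec_apply,
        Sum.elim_inl, Sum.elim_inr, fromBlocks_apply₁₁, Matrix.zero_apply]
      rw [Matrix.mul_apply, Matrix.mul_apply]
      simp only [Matrix.of_apply, Matrix.transpose_apply]
      rw [e1, e2, hG1.apply i c]
      linarith
    · have := hr1 i c j
      rw [c1] at this
      have e1 : ∑ μ, L2 μ i * (-(1 / 2) * eG1 μ c j) = -(1/2) * ∑ μ, L2 μ i * eG1 μ c j := by
        rw [Finset.mul_sum]; exact Finset.sum_congr rfl fun _ _ => by ring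
      have e2 : ∑ a, -(1 / 2) * eG1 i c a * L1 a j = -(1/2) * (eG1 i * L1) c j := by
        rw [Matrix.mul_apply, Finset.mul_sum]
        exact Finset.sum_congr rfl fun _ _ => by ring
      simp only [Matrix.sub_apply, Matrix.add_apply, fromBlocks_apply₂₁, vecMulVec_apply,
        Sum.elim_inl, Sum.elim_inr, fromBlocks_apply₁₁, fromBlocks_apply₁₂, Matrix.zero_apply]
      rw [Matrix.mul_apply, Matrix.mul_apply]
      simp only [Matrix.of_apply, Matrix.transpose_apply]
      rw [e1, e2]
      linarith
    · simp only [Matrix.sub_apply, fromBlocks_apply₂₂, Matrix.add_apply, vecMulVec_apply,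
        Sum.elim_inl, Sum.elim_inr, fromBlocks_apply₁₂, Matrix.zero_apply]
      rw [Matrix.smul_mul, Matrix.mul_smul, c2]
      simp
  · rw [lowC_blocks_inr]
    simp only [Sum.elim_inr, fromBlocks_multiply, fromBlocks_transpose, fromBlocks_add,
      Matrix.transpose_zero, Matrix.mul_zero, Matrix.zero_mul, add_zero, zero_add]
    have hH := H2 c
    ext i j
    rcases i with i | i <;> rcases j with j | j
    · simp only [Matrix.sub_apply, fromBlocks_apply₁₁, Matrix.add_apply, vecMulVec_apply,
        Sum.elim_inl, Sum.elim_inr, fromBlocks_apply₂₁, Matrix.zero_apply]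
      rw [Matrix.smul_mul, Matrix.mul_smul, c1]
      simp
    · have := hr2 i c j
      rw [c2] at this
      have e1 : ∑ μ, L1 μ i * (-(1 / 2) * eG2 μ c j) = -(1/2) * ∑ μ, L1 μ i * eG2 μ c j := by
        rw [Finset.mul_sum]; exact Finset.sum_congr rfl fun _ _ => by ring
      have e2 : ∑ a, -(1 / 2) * eG2 i c a * L2 a j = -(1/2) * (eG2 i * L2) c j := by
        rw [Matrix.mul_apply, Finset.mul_sum]
        exact Finset.sum_congr rfl fun _ _ => by ring
      simp only [Matrix.sub_apply, Matrix.add_apply, fromBlocks_apply₁₂, vecMulVec_apply,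
        Sum.elim_inl, Sum.elim_inr, fromBlocks_apply₂₁, fromBlocks_apply₂₂, Matrix.zero_apply]
      rw [Matrix.mul_apply, Matrix.mul_apply]
      simp only [Matrix.of_apply, Matrix.transpose_apply]
      rw [e1, e2]
      linarith
    · have := hr2 j i c
      have e1 : ∑ μ, 1 / 2 * eG2 μ i c * L1 μ j = 1/2 * ∑ μ, L1 μ j * eG2 μ i c := by
        rw [Finset.mul_sum]; exact Finset.sum_congr rfl fun _ _ => by ring
      have e2 : ∑ a, L2 a i * (1 / 2 * eG2 j a c) = 1/2 * (L2ᵀ * eG2 j) i c := by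
        rw [Matrix.mul_apply, Finset.mul_sum]
        exact Finset.sum_congr rfl fun _ _ => by rw [Matrix.transpose_apply]; ring
      simp only [Matrix.sub_apply, Matrix.add_apply, fromBlocks_apply₂₁, vecMulVec_apply,
        Sum.elim_inl, Sum.elim_inr, fromBlocks_apply₂₂, Matrix.zero_apply]
      rw [Matrix.mul_apply, Matrix.mul_apply]
      simp only [Matrix.of_apply, Matrix.transpose_apply]
      rw [e1, e2, hG2.apply i c]
      linarith
    · have := congrFun (congrFun hH i) j
      simpa [vecMulVec_apply] using this

variable {τ : Type*} [Fintype τ] [DecidableEq τ]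

/-- coordinate restriction as a continuous linear map -/
noncomputable def restr (e : ι → τ) : (τ → ℝ) →L[ℝ] (ι → ℝ) :=
  ContinuousLinearMap.pi fun i => ContinuousLinearMap.proj (e i)

lemma restr_contDiffOn {e : ι → τ} {f : (ι → ℝ) → ℝ} {U : Set (ι → ℝ)} {V : Set (τ → ℝ)}
    (hf : ContDiffOn ℝ (⊤ : ℕ∞) f U) (hV : ∀ z ∈ V, (fun i => z (e i)) ∈ U) :
    ContDiffOn ℝ (⊤ : ℕ∞) (fun z : τ → ℝ => f fun i => z (e i)) V :=
  hf.comp (restr e).contDiff.contDiffOn hV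

lemma restr_diff {e : ι → τ} {f : (ι → ℝ) → ℝ} {z : τ → ℝ}
    (hf : DifferentiableAt ℝ f (fun i => z (e i))) :
    DifferentiableAt ℝ (fun z : τ → ℝ => f fun i => z (e i)) z :=
  DifferentiableAt.comp z (f := restr e) hf (restr e).differentiableAt

lemma restr_pd {e : ι → τ} {f : (ι → ℝ) → ℝ} {z : τ → ℝ} (t : τ)
    (hf : DifferentiableAt ℝ f (fun i => z (e i))) :
    pd t (fun z : τ → ℝ => f fun i => z (e i)) z
      = fderiv ℝ f (fun i => z (e i)) (fun i => (Pi.single t 1 : τ → ℝ) (e i)) := by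
  unfold pd
  have := HasFDerivAt.comp z (f := restr e) (g := f) hf.hasFDerivAt (restr e).hasFDerivAt
  have h2 := this.fderiv
  change fderiv ℝ (f ∘ restr e) z _ = _
  rw [h2]
  rfl

lemma restr_pd_self {e : ι → τ} (he : Function.Injective e) {f : (ι → ℝ) → ℝ} {z : τ → ℝ} (c : ι)
    (hf : DifferentiableAt ℝ f (fun i => z (e i))) :
    pd (e c) (fun z : τ → ℝ => f fun i => z (e i)) z = pd c f (fun i => z (e i)) := by
  rw [restr_pd _ hf, pd]
  congr 1
  ext i
  simp [Pi.single_apply, he.eq_iff]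

lemma restr_pd_other {e : ι → τ} {t : τ} (ht : ∀ i, e i ≠ t) {f : (ι → ℝ) → ℝ} {z : τ → ℝ}
    (hf : DifferentiableAt ℝ f (fun i => z (e i))) :
    pd t (fun z : τ → ℝ => f fun i => z (e i)) z = 0 := by
  rw [restr_pd _ hf]
  have : (fun i => (Pi.single t 1 : τ → ℝ) (e i)) = 0 := by
    ext i; simp [Pi.single_apply, ht]
  rw [this, map_zero]

/-- one diagonal block of the glued metric -/
noncomputable def blk (e : ι → τ) (e' : κ → τ) (h L : (ι → ℝ) → Matrix ι ι ℝ)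
    (N : (κ → ℝ) → Matrix κ κ ℝ) (z : τ → ℝ) : Matrix ι ι ℝ :=
  h (fun i => z (e i)) *
    Polynomial.aeval (L fun i => z (e i)) ((N fun i => z (e' i)).charpoly)

lemma blk_contDiffOn {e : ι → τ} {e' : κ → τ} {h L : (ι → ℝ) → Matrix ι ι ℝ}
    {N : (κ → ℝ) → Matrix κ κ ℝ} {U : Set (ι → ℝ)} {W : Set (κ → ℝ)} {V : Set (τ → ℝ)}
    (hV : ∀ z ∈ V, (fun i => z (e i)) ∈ U) (hV' : ∀ z ∈ V, (fun i => z (e' i)) ∈ W)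
    (hh : ∀ i j, ContDiffOn ℝ (⊤ : ℕ∞) (fun y => h y i j) U)
    (hL : ∀ i j, ContDiffOn ℝ (⊤ : ℕ∞) (fun y => L y i j) U)
    (hN : ∀ i j, ContDiffOn ℝ (⊤ : ℕ∞) (fun y => N y i j) W) (i j : ι) :
    ContDiffOn ℝ (⊤ : ℕ∞) (fun z => blk e e' h L N z i j) V := by
  simp only [blk, aeval_charpoly_sum, Matrix.sum_apply, Matrix.smul_apply, smul_eq_mul]
  refine ContDiffOn.sum fun n _ => ContDiffOn.mul ?_ ?_
  · exact restr_contDiffOn (e := e') (f := fun y => (N y).charpoly.coeff n)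
      (contDiffOn_charpoly hN n) hV'
  · exact restr_contDiffOn (e := e) (f := fun x => (h x * L x ^ n) i j)
      (contDiffOn_mul hh (contDiffOn_pow hL n) i j) hV

lemma blk_pd_self {e : ι → τ} {e' : κ → τ} (he : Function.Injective e)
    (hee : ∀ i j, e i ≠ e' j) {h L : (ι → ℝ) → Matrix ι ι ℝ}
    {N : (κ → ℝ) → Matrix κ κ ℝ} {z : τ → ℝ}
    (hd : ∀ n i j, DifferentiableAt ℝ (fun x => (h x * L x ^ n) i j) (fun i => z (e i)))
    (hN : ∀ n, DifferentiableAt ℝ (fun y => (N y).charpoly.coeff n) (fun i => z (e' i)))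
    (c : ι) :
    matpd (e c) (blk e e' h L N) z
      = ∑ n ∈ Finset.range (Fintype.card κ + 1), (N fun i => z (e' i)).charpoly.coeff n •
        matpd c (fun x => h x * L x ^ n) (fun i => z (e i)) := by
  ext i j
  simp only [matpd, blk, aeval_charpoly_sum, Matrix.sum_apply, Matrix.smul_apply, smul_eq_mul,
    Matrix.of_apply]
  have d1 : ∀ n, DifferentiableAt ℝ
      (fun z : τ → ℝ => (N fun i => z (e' i)).charpoly.coeff n) z := fun n =>
    restr_diff (f := fun y => (N y).charpoly.coeff n) (hN n)
  have d2 : ∀ n, DifferentiableAt ℝ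
      (fun z : τ → ℝ => (h (fun i => z (e i)) * L (fun i => z (e i)) ^ n) i j) z := fun n =>
    restr_diff (f := fun x => (h x * L x ^ n) i j) (hd n i j)
  rw [pd_sum fun n _ => (d1 n).fun_mul (d2 n)]
  refine Finset.sum_congr rfl fun n _ => ?_
  rw [pd_mul (d1 n) (d2 n),
    restr_pd_other (f := fun y => (N y).charpoly.coeff n) (fun k => (hee c k).symm) (hN n),
    restr_pd_self (f := fun x => (h x * L x ^ n) i j) he c (hd n i j)]
  ring

lemma blk_pd_other {e : ι → τ} {e' : κ → τ} (he : Function.Injective e')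
    (hee : ∀ i j, e i ≠ e' j) {h L : (ι → ℝ) → Matrix ι ι ℝ}
    {N : (κ → ℝ) → Matrix κ κ ℝ} {z : τ → ℝ}
    (hd : ∀ n i j, DifferentiableAt ℝ (fun x => (h x * L x ^ n) i j) (fun i => z (e i)))
    (hN : ∀ n, DifferentiableAt ℝ (fun y => (N y).charpoly.coeff n) (fun i => z (e' i)))
    (c : κ) :
    matpd (e' c) (blk e e' h L N) z
      = h (fun i => z (e i)) *
        Polynomial.aeval (L fun i => z (e i)) (dchi c N (fun i => z (e' i))) := by
  rw [aeval_dchi]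
  ext i j
  simp only [matpd, blk, aeval_charpoly_sum, Matrix.sum_apply, Matrix.smul_apply, smul_eq_mul,
    Matrix.of_apply]
  have d1 : ∀ n, DifferentiableAt ℝ
      (fun z : τ → ℝ => (N fun i => z (e' i)).charpoly.coeff n) z := fun n =>
    restr_diff (f := fun y => (N y).charpoly.coeff n) (hN n)
  have d2 : ∀ n, DifferentiableAt ℝ
      (fun z : τ → ℝ => (h (fun i => z (e i)) * L (fun i => z (e i)) ^ n) i j) z := fun n =>
    restr_diff (f := fun x => (h x * L x ^ n) i j) (hd n i j)
  rw [pd_sum fun n _ => (d1 n).fun_mul (d2 n)]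
  refine Finset.sum_congr rfl fun n _ => ?_
  rw [pd_mul (d1 n) (d2 n),
    restr_pd_self (f := fun y => (N y).charpoly.coeff n) he c (hN n),
    restr_pd_other (f := fun x => (h x * L x ^ n) i j) (fun k => hee k c) (hd n i j)]
  ring

/-- all pointwise facts about one diagonal block -/
lemma blk_facts {e : ι → τ} {e' : κ → τ} (he : Function.Injective e)
    (he' : Function.Injective e') (hee : ∀ i j, e i ≠ e' j)
    {h L : (ι → ℝ) → Matrix ι ι ℝ} {k N : (κ → ℝ) → Matrix κ κ ℝ}
    {U : Set (ι → ℝ)} {W : Set (κ → ℝ)} (hU : IsOpen U) (hW : IsOpen W)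
    (H : IsCompatiblePair U h L) (K : IsCompatiblePair W k N)
    {z : τ → ℝ} (hx : (fun i => z (e i)) ∈ U) (hy : (fun i => z (e' i)) ∈ W) :
    AlgCompat (blk e e' h L N z) (fun c => matpd (e c) (blk e e' h L N) z)
      (L fun i => z (e i)) (fun c => matpd c L fun i => z (e i)) (lamOf L fun i => z (e i)) ∧
    (blk e e' h L N z).IsSymm ∧
    (∀ γ, (L fun i => z (e i))ᵀ * matpd (e' γ) (blk e e' h L N) z
      = matpd (e' γ) (blk e e' h L N) z * (L fun i => z (e i))) ∧
    (∀ β, ∑ μ, (N fun i => z (e' i)) μ β • matpd (e' μ) (blk e e' h L N) z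
      - (L fun i => z (e i))ᵀ * matpd (e' β) (blk e e' h L N) z
      = (2 * lamOf N (fun i => z (e' i)) β) • blk e e' h L N z) := by
  have HA := H.alg hU hx
  have KA := K.alg hW hy
  obtain ⟨a, b, c, -⟩ := H
  obtain ⟨a', b', c', -⟩ := K
  obtain ⟨c1, c2, c3, c4⟩ := c _ hx
  obtain ⟨c1', c2', c3', c4'⟩ := c' _ hy
  have dh := fun i j => diffAt_of_contDiffOn hU (a i j) hx
  have dL := fun i j => diffAt_of_contDiffOn hU (b i j) hx
  have dN := fun i j => diffAt_of_contDiffOn hW (b' i j) hy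
  have dc := fun n => diffAt_of_contDiffOn hW (contDiffOn_charpoly b' n) hy
  have hp := pow_compat dh dL c1 c4 (matpd_symm hU (fun y hy => (c y hy).1) hx) HA
  have hps := blk_pd_self he hee (fun n => (hp n).1) dc
  have hpo := blk_pd_other he' hee (fun n => (hp n).1) dc
  refine ⟨?_, ?_, ?_, ?_⟩
  · simp only [hps]
    rw [blk, aeval_charpoly_sum]
    exact AlgCompat.sum _ _ fun n => (hp n).2.2
  · exact aeval_symm c1 c4 _
  · intro γ
    rw [hpo]
    exact (aeval_comm c1 c4 _).1
  · intro β
    simp only [hpo]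
    rw [(aeval_comm c1 c4 _).2]
    have hrow := dchi_row dN dc c1' c2' c4' KA β
    have e1 : ∀ (r : ℝ) (p : ℝ[X]), r • (h (fun i => z (e i)) *
        Polynomial.aeval (L fun i => z (e i)) p)
        = h (fun i => z (e i)) * Polynomial.aeval (L fun i => z (e i)) (Polynomial.C r * p) := by
      intro r p
      rw [map_mul, Polynomial.aeval_C, Algebra.algebraMap_eq_smul_one, Matrix.smul_mul, one_mul,
        Matrix.mul_smul]
    rw [blk]
    simp only [e1]
    rw [← Finset.mul_sum, ← map_sum, ← mul_sub, ← map_sub, hrow]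

lemma aeval_isUnit {A : Matrix ι ι ℝ} {B : Matrix κ κ ℝ}
    (hs : ∀ μ : ℂ, ¬(Polynomial.aeval μ A.charpoly = 0 ∧ Polynomial.aeval μ B.charpoly = 0)) :
    IsUnit (Polynomial.aeval A B.charpoly).det := by
  have hc : IsCoprime A.charpoly B.charpoly := by
    rw [Polynomial.isCoprime_iff_aeval_ne_zero_of_isAlgClosed ℝ ℂ]
    intro μ
    have := hs μ
    tauto
  obtain ⟨p, q, hpq⟩ := hc
  have := congrArg (Polynomial.aeval A) hpq
  rw [map_add, map_mul, map_mul, Matrix.aeval_self_charpoly, mul_zero, zero_add, map_one] at this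
  rw [← Matrix.isUnit_iff_isUnit_det]
  exact IsUnit.of_mul_eq_one_right _ this

end GluingPart
/-- Gluing Lemma in local coordinates. -/
theorem gluing_lemma (m k : ℕ)
    (U1 : Set (Fin m → ℝ)) (U2 : Set (Fin k → ℝ))
    (hU1 : IsOpen U1) (hU2 : IsOpen U2)
    (h1 L1 : (Fin m → ℝ) → Matrix (Fin m) (Fin m) ℝ)
    (h2 L2 : (Fin k → ℝ) → Matrix (Fin k) (Fin k) ℝ)
    (hc1 : IsCompatiblePair U1 h1 L1)
    (hc2 : IsCompatiblePair U2 h2 L2)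
    (hspec : ∀ x ∈ U1, ∀ y ∈ U2, ∀ μ : ℂ,
      ¬(Polynomial.aeval μ ((L1 x).charpoly) = 0 ∧
        Polynomial.aeval μ ((L2 y).charpoly) = 0)) :
    let U : Set ((Fin m ⊕ Fin k) → ℝ) :=
      {x | (fun i => x (Sum.inl i)) ∈ U1 ∧ (fun i => x (Sum.inr i)) ∈ U2}
    let L : ((Fin m ⊕ Fin k) → ℝ) → Matrix (Fin m ⊕ Fin k) (Fin m ⊕ Fin k) ℝ :=
      fun x => Matrix.fromBlocks (L1 fun i => x (Sum.inl i)) 0 0 (L2 fun i => x (Sum.inr i))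
    let g : ((Fin m ⊕ Fin k) → ℝ) → Matrix (Fin m ⊕ Fin k) (Fin m ⊕ Fin k) ℝ :=
      fun x => Matrix.fromBlocks
        (h1 (fun i => x (Sum.inl i)) *
          Polynomial.aeval (L1 fun i => x (Sum.inl i)) ((L2 fun i => x (Sum.inr i)).charpoly))
        0 0
        (h2 (fun i => x (Sum.inr i)) *
          Polynomial.aeval (L2 fun i => x (Sum.inr i)) ((L1 fun i => x (Sum.inl i)).charpoly))
    (∀ x ∈ U, (g x).IsSymm ∧ IsUnit (g x).det ∧ IsUnit (L x).det ∧ (g x * L x).IsSymm) ∧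
    IsCompatiblePair U g L := by
  intro U L g
  have hUo : IsOpen U := by
    have o1 : IsOpen {z : (Fin m ⊕ Fin k) → ℝ | (fun i => z (Sum.inl i)) ∈ U1} :=
      hU1.preimage (by fun_prop)
    have o2 : IsOpen {z : (Fin m ⊕ Fin k) → ℝ | (fun i => z (Sum.inr i)) ∈ U2} :=
      hU2.preimage (by fun_prop)
    exact o1.inter o2
  have hgdef : ∀ z, g z = fromBlocks (blk Sum.inl Sum.inr h1 L1 L2 z) 0 0
      (blk Sum.inr Sum.inl h2 L2 L1 z) := fun z => rfl
  have hA : ∀ z ∈ U, (g z).IsSymm ∧ IsUnit (g z).det ∧ IsUnit (L z).det ∧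
      (g z * L z).IsSymm := by
    rintro z ⟨hz1, hz2⟩
    obtain ⟨a1, a2, a3, a4⟩ := hc1.2.2.1 _ hz1
    obtain ⟨b1, b2, b3, b4⟩ := hc2.2.2.1 _ hz2
    refine ⟨?_, ?_, ?_, ?_⟩
    · rw [hgdef]
      exact Matrix.IsSymm.fromBlocks (aeval_symm a1 a4 _) (by simp) (aeval_symm b1 b4 _)
    · rw [hgdef, Matrix.det_fromBlocks_zero₂₁, blk, blk, Matrix.det_mul, Matrix.det_mul]
      refine (a2.mul (aeval_isUnit (hspec _ hz1 _ hz2))).mul (b2.mul (aeval_isUnit ?_))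
      intro μ hμ
      exact hspec _ hz1 _ hz2 μ hμ.symm
    · simp only [L]
      rw [Matrix.det_fromBlocks_zero₂₁]
      exact a3.mul b3
    · rw [hgdef]
      simp only [L]
      rw [fromBlocks_multiply]
      simp only [Matrix.mul_zero, Matrix.zero_mul, add_zero, zero_add]
      refine Matrix.IsSymm.fromBlocks ?_ (by simp) ?_
      · rw [blk, ← (aeval_comm a1 a4 _).1, (aeval_comm a1 a4 _).2]
        exact aeval_symm a1 a4 _
      · rw [blk, ← (aeval_comm b1 b4 _).1, (aeval_comm b1 b4 _).2]
        exact aeval_symm b1 b4 _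
  refine ⟨hA, ?_⟩
  have hgs : ∀ i j, ContDiffOn ℝ (⊤ : ℕ∞) (fun y => g y i j) U := by
    rintro (i | i) (j | j)
    · exact blk_contDiffOn (fun z hz => hz.1) (fun z hz => hz.2) hc1.1 hc1.2.1 hc2.2.1 i j
    · exact contDiffOn_const
    · exact contDiffOn_const
    · exact blk_contDiffOn (fun z hz => hz.2) (fun z hz => hz.1) hc2.1 hc2.2.1 hc1.2.1 i j
  have hLs : ∀ i j, ContDiffOn ℝ (⊤ : ℕ∞) (fun y => L y i j) U := by
    rintro (i | i) (j | j)
    · exact restr_contDiffOn (e := Sum.inl) (hc1.2.1 i j) (fun z hz => hz.1)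
    · exact contDiffOn_const
    · exact contDiffOn_const
    · exact restr_contDiffOn (e := Sum.inr) (hc2.2.1 i j) (fun z hz => hz.2)
  refine ⟨hgs, hLs, hA, ?_⟩
  intro z hz
  obtain ⟨s1, s2, s3, s4⟩ := hA z hz
  refine (compat_iff (fun i j => diffAt_of_contDiffOn hUo (hgs i j) hz)
    (fun i j => diffAt_of_contDiffOn hUo (hLs i j) hz) s1 s2 s4
    (matpd_symm hUo (fun y hy => (hA y hy).1) hz) (lamOf L z)).2 ?_
  obtain ⟨f1, f2, f3, f4⟩ := blk_facts (τ := Fin m ⊕ Fin k) Sum.inl_injective Sum.inr_injective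
    (fun i j => Sum.inl_ne_inr) hU1 hU2 hc1 hc2 hz.1 hz.2
  obtain ⟨p1, p2, p3, p4⟩ := blk_facts (τ := Fin m ⊕ Fin k) Sum.inr_injective Sum.inl_injective
    (fun i j => Sum.inr_ne_inl) hU2 hU1 hc2 hc1 hz.2 hz.1
  have key := glue_alg f1 p1 f2 p2 f3 p3 f4 p4
  have dL1 := fun i j => diffAt_of_contDiffOn hU1 (hc1.2.1 i j) hz.1
  have dL2 := fun i j => diffAt_of_contDiffOn hU2 (hc2.2.1 i j) hz.2
  have eg : (fun k => matpd k g z) = Sum.elim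
      (fun c => fromBlocks (matpd (Sum.inl c) (blk Sum.inl Sum.inr h1 L1 L2) z) 0 0
        (matpd (Sum.inl c) (blk Sum.inr Sum.inl h2 L2 L1) z))
      (fun c => fromBlocks (matpd (Sum.inr c) (blk Sum.inl Sum.inr h1 L1 L2) z) 0 0
        (matpd (Sum.inr c) (blk Sum.inr Sum.inl h2 L2 L1) z)) := by
    funext c
    rcases c with c | c <;> ext i j <;> rcases i with i | i <;> rcases j with j | j <;>
      first
      | rfl
      | exact pd_const 0
  have eL : (fun k => matpd k L z) = Sum.elim
      (fun c => fromBlocks (matpd c L1 fun i => z (Sum.inl i)) 0 0 0)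
      (fun c => fromBlocks 0 0 0 (matpd c L2 fun i => z (Sum.inr i))) := by
    funext c
    rcases c with c | c <;> ext i j <;> rcases i with i | i <;> rcases j with j | j
    · exact restr_pd_self Sum.inl_injective c (dL1 i j)
    · exact pd_const 0
    · exact pd_const 0
    · exact restr_pd_other (fun _ => Sum.inr_ne_inl) (dL2 i j)
    · exact restr_pd_other (fun _ => Sum.inl_ne_inr) (dL1 i j)
    · exact pd_const 0
    · exact pd_const 0
    · exact restr_pd_self Sum.inr_injective c (dL2 i j)
  have el : lamOf L z = Sum.elim (lamOf L1 fun i => z (Sum.inl i))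
      (lamOf L2 fun i => z (Sum.inr i)) := by
    have t1 : DifferentiableAt ℝ (fun y => (1/2) * (L1 y).trace) (fun i => z (Sum.inl i)) :=
      (DifferentiableAt.fun_sum fun i _ => dL1 i i).const_mul _
    have t2 : DifferentiableAt ℝ (fun y => (1/2) * (L2 y).trace) (fun i => z (Sum.inr i)) :=
      (DifferentiableAt.fun_sum fun i _ => dL2 i i).const_mul _
    have e : (fun z => (1/2) * (L z).trace) = fun z => (1/2) * (L1 fun i => z (Sum.inl i)).trace
        + (1/2) * (L2 fun i => z (Sum.inr i)).trace := by
      funext z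
      simp only [L, Matrix.trace, Matrix.diag, Fintype.sum_sum_type, fromBlocks_apply₁₁,
        fromBlocks_apply₂₂, mul_add]
    funext c
    rw [lamOf, e, pd_add (restr_diff (e := Sum.inl) t1) (restr_diff (e := Sum.inr) t2)]
    rcases c with c | c
    · rw [restr_pd_self (e := Sum.inl) Sum.inl_injective c t1,
        restr_pd_other (e := Sum.inr) (fun _ => Sum.inr_ne_inl) t2, add_zero]
      rfl
    · rw [restr_pd_self (e := Sum.inr) Sum.inr_injective c t2,
        restr_pd_other (e := Sum.inl) (fun _ => Sum.inl_ne_inr) t1, zero_add]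
      rfl
  rw [eg, eL, el]
  exact key
end

section
/- Simultaneous canonical form of a nondegenerate symmetric bilinear form and a selfadjoint operator. Let G ∈ Mat_n(ℝ) be symmetric and invertible and let L ∈ Mat_n(ℝ) satisfy Lᵀ G = G L (L is G-selfadjoint). Then there exists an invertible P ∈ Mat_n(ℝ) such that P^{-1} L P and Pᵀ G P are simultaneously block diagonal with blocks of equal sizes, where the j-th block of P^{-1} L P is either (i) a real Jordan block: λ_j on the diagonal, 1 on the superdiagonal, 0 elsewhere, for some λ_j ∈ ℝ, or (ii) a realified complex Jordan block of even size: 2×2 blocks [[a_j, −b_j], [b_j, a_j]] (with b_j ≠ 0) down the block diagonal and 2×2 identity blocks on the block superdiagonal, 0 elsewhere; and the j-th block of Pᵀ G P is ε_j times the anti-diagonal identity matrix of the same size (entries ε_j in positions (i, s+1−i) for a block of size s, 0 elsewhere), with ε_j ∈ {+1, −1} in case (i) and ε_j = 1 in case (ii). -/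
open Matrix

/-- A real Jordan block of size `s` with eigenvalue `l`. -/
def rJordanBlk (s : ℕ) (l : ℝ) : Matrix (Fin s) (Fin s) ℝ :=
  fun i j =>
    if i = j then l
    else if (j : ℕ) = (i : ℕ) + 1 then 1
    else 0

/-- A realified complex Jordan block of (even) size `s` with eigenvalues a ± ib:
2×2 blocks [[a, -b], [b, a]] down the block diagonal and 2×2 identity blocks
on the block superdiagonal. -/
def cJordanBlk (s : ℕ) (a b : ℝ) : Matrix (Fin s) (Fin s) ℝ :=
  fun i j =>
    if i = j then a
    else if (j : ℕ) = (i : ℕ) + 1 ∧ (i : ℕ) % 2 = 0 then -b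
    else if (i : ℕ) = (j : ℕ) + 1 ∧ (j : ℕ) % 2 = 0 then b
    else if (j : ℕ) = (i : ℕ) + 2 then 1
    else 0

/-- ε times the anti-diagonal identity matrix of size `s`. -/
def antiDiagBlk (s : ℕ) (ε : ℝ) : Matrix (Fin s) (Fin s) ℝ :=
  fun i j => if (i : ℕ) + (j : ℕ) + 1 = s then ε else 0

section gen
variable {K V : Type*} [Field K] [CharZero K] [AddCommGroup V] [Module K V]

lemma scf_aeval_sa (B : V →ₗ[K] V →ₗ[K] K) (L : Module.End K V)
    (sa : ∀ x y, B (L x) y = B x (L y)) (p : Polynomial K) (x y : V) :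
    B (Polynomial.aeval L p x) y = B x (Polynomial.aeval L p y) := by
  induction p using Polynomial.induction_on' generalizing x y with
  | add p q hp hq => simp [hp, hq]
  | monomial k c =>
    have h : ∀ k x y, B ((L ^ k) x) y = B x ((L ^ k) y) := by
      intro k
      induction k with
      | zero => simp
      | succ k ih =>
        intro x y
        rw [pow_succ, Module.End.mul_apply, ih, sa, ← Module.End.mul_apply, ← pow_succ', pow_succ]
    simp [Polynomial.aeval_monomial, Module.algebraMap_end_apply, h]

lemma scf_pow_sa (B : V →ₗ[K] V →ₗ[K] K) (L : Module.End K V)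
    (sa : ∀ x y, B (L x) y = B x (L y)) (k : ℕ) (x y : V) :
    B ((L ^ k) x) y = B x ((L ^ k) y) := by
  simpa using scf_aeval_sa B L sa (Polynomial.X ^ k) x y

lemma scf_start [FiniteDimensional K V] (B : V →ₗ[K] V →ₗ[K] K) (L : Module.End K V)
    (symm : ∀ x y, B x y = B y x) (nd : ∀ x, (∀ y, B x y = 0) → x = 0)
    (sa : ∀ x y, B (L x) y = B x (L y)) (l : K) (hl : L.HasEigenvalue l) :
    ∃ (M : ℕ) (u : V), ((L - algebraMap K _ l) ^ (M+1)) u = 0 ∧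
      B (((L - algebraMap K _ l) ^ M) u) u ≠ 0 := by
  classical
  have hLint := Algebra.IsIntegral.isIntegral (R := K) L
  have hne : minpoly K L ≠ 0 := minpoly.ne_zero hLint
  have hroot := Module.End.isRoot_of_hasEigenvalue hl
  obtain ⟨q, hq, hnd⟩ := Polynomial.exists_eq_pow_rootMultiplicity_mul_and_not_dvd _ hne l
  have hpos := (Polynomial.rootMultiplicity_pos hne).2 hroot
  obtain ⟨M, hM⟩ := Nat.exists_eq_add_of_lt hpos
  rw [zero_add] at hM
  rw [hM] at hq
  have hT : Polynomial.aeval L (Polynomial.X - Polynomial.C l) = L - algebraMap K _ l := by simp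
  set p := (Polynomial.X - Polynomial.C l) with hp
  have hh : Polynomial.aeval L (p ^ M * q ^ 2) ≠ 0 := by
    intro h0
    have := minpoly.dvd K L h0
    rw [hq] at this
    have e : p ^ M * q ^ 2 = (p ^ M * q) * q := by ring
    have e2 : p ^ (M+1) * q = (p ^ M * q) * p := by ring
    rw [e, e2] at this
    refine hnd ((mul_dvd_mul_iff_left ?_).1 this)
    intro h
    apply hne
    rw [hq, e2, h, zero_mul]
  have : ∃ x, B (Polynomial.aeval L (p ^ M * q ^ 2) x) x ≠ 0 := by
    by_contra! hz
    apply hh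
    ext x
    apply nd
    intro y
    have h1 := hz (x + y)
    simp only [map_add, LinearMap.add_apply, hz, zero_add, add_zero] at h1
    rw [scf_aeval_sa B L sa _ y x, symm y] at h1
    have h2 : (2 : K) * B (Polynomial.aeval L (p ^ M * q ^ 2) x) y = 0 := by linear_combination h1
    simpa using h2
  obtain ⟨x, hx⟩ := this
  refine ⟨M, Polynomial.aeval L q x, ?_, ?_⟩
  · rw [← hT, ← map_pow, ← Module.End.mul_apply, ← map_mul, ← hq, minpoly.aeval]; simp
  · rw [← hT, ← map_pow, ← scf_aeval_sa B L sa, ← Module.End.mul_apply, ← Module.End.mul_apply,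
      ← map_mul, ← map_mul]
    convert hx using 5
    ring

lemma scf_norm (B : V →ₗ[K] V →ₗ[K] K) (T : Module.End K V)
    (sa : ∀ x y, B (T x) y = B x (T y)) (M : ℕ) (u : V) (c : K)
    (hu : (T ^ (M+1)) u = 0) (hc : B ((T ^ M) u) u = c) (hc0 : c ≠ 0) :
    ∃ v : V, (T ^ (M+1)) v = 0 ∧ ∀ i, B ((T ^ i) v) v = if i = M then c else 0 := by
  have hz : ∀ v : V, (T ^ (M+1)) v = 0 → ∀ i, M < i → (T ^ i) v = 0 := by
    intro v hv i hi
    obtain ⟨d, rfl⟩ := Nat.exists_eq_add_of_le (Nat.succ_le_of_lt hi)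
    rw [Nat.succ_eq_add_one, add_comm, pow_add, Module.End.mul_apply, hv, map_zero]
  have main : ∀ k, ∃ v : V, (T ^ (M+1)) v = 0 ∧ B ((T ^ M) v) v = c ∧
      ∀ i, i < M → M ≤ i + k → B ((T ^ i) v) v = 0 := by
    intro k
    induction k with
    | zero => exact ⟨u, hu, hc, fun i h1 h2 => by omega⟩
    | succ k ih =>
      obtain ⟨v, hv, hvc, hv0⟩ := ih
      by_cases hk : M < k + 1
      · exact ⟨v, hv, hvc, fun i h1 h2 => hv0 i h1 (by omega)⟩
      push Not at hk
      set α : K := - B ((T ^ (M - (k+1))) v) v / (2 * c) with hα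
      have ex : ∀ i, B ((T ^ i) (v + α • (T ^ (k+1)) v)) (v + α • (T ^ (k+1)) v) =
          B ((T ^ i) v) v + 2 * α * B ((T ^ (i + (k+1))) v) v
            + α ^ 2 * B ((T ^ (i + (k+1) + (k+1))) v) v := by
        intro i
        have e1 : B ((T ^ i) v) ((T ^ (k+1)) v) = B ((T ^ (i + (k+1))) v) v := by
          rw [← scf_pow_sa B T sa (k+1), ← Module.End.mul_apply, ← pow_add, add_comm]
        have e2 : B ((T ^ (i + (k+1))) v) ((T ^ (k+1)) v) = B ((T ^ (i + (k+1) + (k+1))) v) v := by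
          rw [← scf_pow_sa B T sa (k+1), ← Module.End.mul_apply, ← pow_add, add_comm]
        have e3 : (T ^ i) ((T ^ (k+1)) v) = (T ^ (i + (k+1))) v := by
          rw [← Module.End.mul_apply, ← pow_add]
        simp only [map_add, map_smul, LinearMap.add_apply, LinearMap.smul_apply, smul_eq_mul, e1,
          e2, e3]
        ring
      refine ⟨v + α • (T ^ (k+1)) v, ?_, ?_, ?_⟩
      · rw [map_add, map_smul, hv, ← Module.End.mul_apply, ← pow_add, hz v hv _ (by omega)]; simp
      · rw [ex, hz v hv (M + (k+1)) (by omega), hz v hv (M + (k+1) + (k+1)) (by omega)]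
        simp [hvc]
      · intro i h1 h2
        rw [ex]
        by_cases h3 : M ≤ i + k
        · rw [hv0 i h1 h3, hz v hv (i + (k+1)) (by omega), hz v hv (i + (k+1) + (k+1)) (by omega)]
          simp
        · have h4 : i + (k+1) = M := by omega
          have h5 : i = M - (k+1) := by omega
          rw [hz v hv (i + (k+1) + (k+1)) (by omega), h4, hvc, hα, ← h5]
          field_simp
          simp
  obtain ⟨v, hv, hvc, hv0⟩ := main M
  refine ⟨v, hv, fun i => ?_⟩
  split_ifs with h
  · rw [h, hvc]
  · by_cases h2 : i < M
    · exact hv0 i h2 (by omega)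
    · rw [hz v hv i (by omega)]; simp

/-- pairing of kernels for distinct eigenvalues -/
lemma scf_orth (B : V →ₗ[K] V →ₗ[K] K) (L : Module.End K V)
    (sa : ∀ x y, B (L x) y = B x (L y)) (l l' : K) (hne : l ≠ l') (m : ℕ) (x y : V)
    (hx : ((L - algebraMap K _ l) ^ m) x = 0) (hy : ((L - algebraMap K _ l') ^ m) y = 0) :
    B x y = 0 := by
  obtain ⟨p, q, hpq⟩ : IsCoprime ((Polynomial.X - Polynomial.C l) ^ m)
      ((Polynomial.X - Polynomial.C l') ^ m) :=
    (Polynomial.isCoprime_X_sub_C_of_isUnit_sub (sub_ne_zero.2 hne).isUnit).pow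
  have h1 : Polynomial.aeval L ((Polynomial.X - Polynomial.C l) ^ m) x = 0 := by simpa using hx
  have h2 : Polynomial.aeval L ((Polynomial.X - Polynomial.C l') ^ m) y = 0 := by simpa using hy
  have h3 : x = Polynomial.aeval L (p * ((Polynomial.X - Polynomial.C l) ^ m) +
    q * ((Polynomial.X - Polynomial.C l') ^ m)) x := by rw [hpq]; simp
  rw [h3, map_add, map_mul, LinearMap.add_apply, Module.End.mul_apply, h1, map_zero, zero_add,
    scf_aeval_sa B L sa, map_mul, Module.End.mul_apply, h2, map_zero, map_zero]
end gen
/-- Data of one block. -/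
structure ScfBlk where
  s : ℕ
  isC : Bool
  a : ℝ
  b : ℝ
  ε : ℝ

/-- operator block -/
noncomputable def ScfBlk.C (d : ScfBlk) : Matrix (Fin d.s) (Fin d.s) ℝ :=
  if d.isC then cJordanBlk d.s d.a d.b else rJordanBlk d.s d.a

/-- admissible block -/
def ScfBlk.OK (d : ScfBlk) : Prop :=
  if d.isC then (Even d.s ∧ d.b ≠ 0 ∧ d.ε = 1) else (d.ε = 1 ∨ d.ε = -1)

lemma ScfBlk.OK.sq {d : ScfBlk} (h : d.OK) : d.ε * d.ε = 1 := by
  unfold ScfBlk.OK at h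
  split_ifs at h
  · simp [h.2.2]
  · rcases h with h | h <;> simp [h]

section real
variable {V : Type*} [AddCommGroup V] [Module ℝ V]

/-- A family of vectors realizing a block. -/
def ScfReal (B : V →ₗ[ℝ] V →ₗ[ℝ] ℝ) (L : Module.End ℝ V) (d : ScfBlk) (w : Fin d.s → V) : Prop :=
  (∀ j, L (w j) = ∑ l, d.C l j • w l) ∧
  (∀ i j, B (w i) (w j) = antiDiagBlk d.s d.ε i j)

lemma scf_key_real [FiniteDimensional ℝ V] (B : V →ₗ[ℝ] V →ₗ[ℝ] ℝ) (L : Module.End ℝ V)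
    (symm : ∀ x y, B x y = B y x) (nd : ∀ x, (∀ y, B x y = 0) → x = 0)
    (sa : ∀ x y, B (L x) y = B x (L y)) (l : ℝ) (hl : L.HasEigenvalue l) :
    ∃ (d : ScfBlk) (w : Fin d.s → V), d.OK ∧ 0 < d.s ∧ ScfReal B L d w := by
  obtain ⟨M, u, hu, hc⟩ := scf_start B L symm nd sa l hl
  set T : Module.End ℝ V := L - algebraMap ℝ _ l with hT
  have saT : ∀ x y, B (T x) y = B x (T y) := by
    intro x y; simp [hT, sa, Module.algebraMap_end_apply]
  set c := B ((T ^ M) u) u with hcdef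
  set r := (Real.sqrt |c|)⁻¹ with hr
  have hcpos : 0 < |c| := abs_pos.2 hc
  have hrr : r * r = |c|⁻¹ := by
    rw [hr, ← mul_inv, Real.mul_self_sqrt hcpos.le]
  obtain ⟨v, hv, hvi⟩ := scf_norm B T saT M (r • u) (|c|⁻¹ * c) (by simp [hu])
    (by simp only [map_smul, LinearMap.smul_apply, smul_eq_mul]; rw [← mul_assoc, hrr])
    (mul_ne_zero (inv_ne_zero hcpos.ne') hc)
  have hε : |c|⁻¹ * c = 1 ∨ |c|⁻¹ * c = -1 := by
    rcases abs_cases c with h | h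
    · left; rw [h.1]; exact inv_mul_cancel₀ hc
    · right; rw [h.1]; field_simp
  refine ⟨⟨M+1, false, l, 0, |c|⁻¹ * c⟩, fun j => (T ^ (M - (j:ℕ))) v, ?_, by simp, ?_, ?_⟩
  · simpa [ScfBlk.OK] using hε
  · intro j
    change Fin (M+1) at j
    have e : ∀ x, L x = l • x + T x := by intro x; simp [hT, Module.algebraMap_end_apply]
    rw [e, ← Module.End.mul_apply, ← pow_succ']
    simp only [ScfBlk.C]
    have : ∀ i : Fin (M+1), rJordanBlk (M+1) l i j • (T ^ (M - (i:ℕ))) v =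
        (if i = j then l • (T ^ (M - (i:ℕ))) v else 0) +
        (if (j:ℕ) = (i:ℕ) + 1 then (T ^ (M - (i:ℕ))) v else 0) := by
      intro i
      simp only [rJordanBlk]
      split_ifs with h1 h2 <;> first | (subst h1; omega) | simp
    have hs : (∑ i : Fin (M+1), if (j:ℕ) = (i:ℕ) + 1 then (T ^ (M - (i:ℕ))) v else 0)
        = (T ^ (M - (j:ℕ) + 1)) v := by
      rcases Nat.eq_zero_or_pos (j:ℕ) with h0 | h0
      · rw [h0, Finset.sum_eq_zero]
        · simpa using hv.symm
        · intro i _; simp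
      · rw [Finset.sum_eq_single (⟨(j:ℕ) - 1, by omega⟩ : Fin (M+1))]
        · rw [if_pos (by simp; omega)]
          congr 2; simp; omega
        · intro i _ hi
          rw [if_neg]
          intro h; apply hi; ext; simp; omega
        · simp
    simp only [Bool.false_eq_true, if_false, this, Finset.sum_add_distrib, hs]
    simp
  · intro i j
    rw [← scf_pow_sa B T saT, ← Module.End.mul_apply, ← pow_add, hvi]
    simp only [antiDiagBlk]
    congr 1
    simp; omega
end real
section cplx
variable {n : ℕ}

/-- real part -/
def scfRe (u : Fin n → ℂ) : Fin n → ℝ := fun i => (u i).re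
/-- imaginary part -/
def scfIm (u : Fin n → ℂ) : Fin n → ℝ := fun i => (u i).im
/-- assemble -/
noncomputable def scfMk (x y : Fin n → ℝ) : Fin n → ℂ := fun i => ⟨x i, y i⟩

@[simp] lemma scfRe_mk (x y : Fin n → ℝ) : scfRe (scfMk x y) = x := rfl
@[simp] lemma scfIm_mk (x y : Fin n → ℝ) : scfIm (scfMk x y) = y := rfl
lemma scf_ext {u v : Fin n → ℂ} (h1 : scfRe u = scfRe v) (h2 : scfIm u = scfIm v) : u = v := by
  funext i
  exact Complex.ext (congrFun h1 i) (congrFun h2 i)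
@[simp] lemma scfRe_add (u v : Fin n → ℂ) : scfRe (u + v) = scfRe u + scfRe v := rfl
@[simp] lemma scfIm_add (u v : Fin n → ℂ) : scfIm (u + v) = scfIm u + scfIm v := rfl
@[simp] lemma scfRe_sub (u v : Fin n → ℂ) : scfRe (u - v) = scfRe u - scfRe v := rfl
@[simp] lemma scfIm_sub (u v : Fin n → ℂ) : scfIm (u - v) = scfIm u - scfIm v := rfl
@[simp] lemma scfRe_zero : scfRe (0 : Fin n → ℂ) = 0 := rfl
@[simp] lemma scfIm_zero : scfIm (0 : Fin n → ℂ) = 0 := rfl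
@[simp] lemma scfRe_smul (c : ℂ) (u : Fin n → ℂ) :
    scfRe (c • u) = c.re • scfRe u - c.im • scfIm u := by
  funext i; simp [scfRe, scfIm]
@[simp] lemma scfIm_smul (c : ℂ) (u : Fin n → ℂ) :
    scfIm (c • u) = c.re • scfIm u + c.im • scfRe u := by
  funext i; simp [scfRe, scfIm]

/-- complexified operator -/
noncomputable def scfL (L : Module.End ℝ (Fin n → ℝ)) : Module.End ℂ (Fin n → ℂ) where
  toFun u := scfMk (L (scfRe u)) (L (scfIm u))
  map_add' u v := by apply scf_ext <;> simp
  map_smul' c u := by apply scf_ext <;> simp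

@[simp] lemma scfRe_L (L : Module.End ℝ (Fin n → ℝ)) (u) : scfRe (scfL L u) = L (scfRe u) := rfl
@[simp] lemma scfIm_L (L : Module.End ℝ (Fin n → ℝ)) (u) : scfIm (scfL L u) = L (scfIm u) := rfl

/-- complexified form -/
noncomputable def scfB (B : (Fin n → ℝ) →ₗ[ℝ] (Fin n → ℝ) →ₗ[ℝ] ℝ) :
    (Fin n → ℂ) →ₗ[ℂ] (Fin n → ℂ) →ₗ[ℂ] ℂ :=
  LinearMap.mk₂ ℂ (fun u v => (⟨B (scfRe u) (scfRe v) - B (scfIm u) (scfIm v),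
      B (scfRe u) (scfIm v) + B (scfIm u) (scfRe v)⟩ : ℂ))
    (by intro u u' v; apply Complex.ext <;> simp <;> ring)
    (by intro c u v; apply Complex.ext <;> simp <;> ring)
    (by intro u u' v; apply Complex.ext <;> simp <;> ring)
    (by intro c u v; apply Complex.ext <;> simp <;> ring)

lemma scfB_re (B : (Fin n → ℝ) →ₗ[ℝ] (Fin n → ℝ) →ₗ[ℝ] ℝ) (u v) :
    (scfB B u v).re = B (scfRe u) (scfRe v) - B (scfIm u) (scfIm v) := rfl
lemma scfB_im (B : (Fin n → ℝ) →ₗ[ℝ] (Fin n → ℝ) →ₗ[ℝ] ℝ) (u v) :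
    (scfB B u v).im = B (scfRe u) (scfIm v) + B (scfIm u) (scfRe v) := rfl

/-- conjugation -/
noncomputable def scfConj (u : Fin n → ℂ) : Fin n → ℂ := scfMk (scfRe u) (-scfIm u)

lemma scfConj_pow (L : Module.End ℝ (Fin n → ℝ)) (l : ℂ) (k : ℕ) (u : Fin n → ℂ) :
    ((scfL L - algebraMap ℂ _ ((starRingEnd ℂ) l)) ^ k) (scfConj u) =
      scfConj (((scfL L - algebraMap ℂ _ l) ^ k) u) := by
  induction k with
  | zero => rfl
  | succ k ih =>
    rw [pow_succ', pow_succ', Module.End.mul_apply, Module.End.mul_apply, ih]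
    generalize ((scfL L - algebraMap ℂ _ l) ^ k) u = z
    simp only [LinearMap.sub_apply, Module.algebraMap_end_apply]
    apply scf_ext
    · simp [scfConj]
    · simp [scfConj]; abel

lemma scf_sum_one {V : Type*} [AddCommGroup V] (s t : ℕ) (g : ℕ → V) (p : ℕ → Prop)
    [DecidablePred p] (ht : t < s) (h : ∀ l, p l ↔ l = t) :
    (∑ l ∈ Finset.range s, if p l then g l else 0) = g t := by
  simp [h, ht]

lemma scf_key_cplx (B : (Fin n → ℝ) →ₗ[ℝ] (Fin n → ℝ) →ₗ[ℝ] ℝ) (L : Module.End ℝ (Fin n → ℝ))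
    (symm : ∀ x y, B x y = B y x) (nd : ∀ x, (∀ y, B x y = 0) → x = 0)
    (sa : ∀ x y, B (L x) y = B x (L y)) (l : ℂ) (hl : (scfL L).HasEigenvalue l)
    (him : l.im ≠ 0) :
    ∃ (d : ScfBlk) (w : Fin d.s → (Fin n → ℝ)), d.OK ∧ 0 < d.s ∧ ScfReal B L d w := by
  have saC : ∀ x y, scfB B (scfL L x) y = scfB B x (scfL L y) := by
    intro x y; apply Complex.ext <;> simp [scfB_re, scfB_im, sa]
  have symmC : ∀ x y, scfB B x y = scfB B y x := by
    intro x y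
    apply Complex.ext
    · rw [scfB_re, scfB_re, symm (scfRe x), symm (scfIm x)]
    · rw [scfB_im, scfB_im, symm (scfRe x), symm (scfIm x), add_comm]
  have ndC : ∀ x, (∀ y, scfB B x y = 0) → x = 0 := by
    intro x hx
    apply scf_ext
    · apply nd
      intro y
      simpa [scfB_re] using congrArg Complex.re (hx (scfMk y 0))
    · apply nd
      intro y
      simpa [scfB_im] using congrArg Complex.im (hx (scfMk y 0))
  obtain ⟨M, u, hu, hc⟩ := scf_start (scfB B) (scfL L) symmC ndC saC l hl
  set T : Module.End ℂ (Fin n → ℂ) := scfL L - algebraMap ℂ _ l with hT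
  have saT : ∀ x y, scfB B (T x) y = scfB B x (T y) := by
    intro x y; simp [hT, saC, Module.algebraMap_end_apply]
  set c := scfB B ((T ^ M) u) u with hcdef
  obtain ⟨r, hr⟩ := IsAlgClosed.exists_pow_nat_eq (2 * Complex.I / c) (n := 2) (by norm_num)
  obtain ⟨v, hv, hvi⟩ := scf_norm (scfB B) T saT M (r • u) (2 * Complex.I) (by simp [hu])
    (by simp only [map_smul, LinearMap.smul_apply, smul_eq_mul]
        rw [← mul_assoc, ← pow_two, hr, ← hcdef]; field_simp) (by simp)
  -- orthogonality with the conjugates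
  have hW : ∀ i, (T ^ (M+1)) ((T ^ i) v) = 0 := by
    intro i
    rw [← Module.End.mul_apply, ← pow_add, add_comm, pow_add, Module.End.mul_apply, hv, map_zero]
  have horth : ∀ i j, scfB B ((T ^ i) v) (scfConj ((T ^ j) v)) = 0 := by
    intro i j
    refine scf_orth (scfB B) (scfL L) saC l ((starRingEnd ℂ) l) ?_ (M+1) _ _ (hW i) ?_
    · intro h
      exact him (Complex.conj_eq_iff_im.1 h.symm)
    · rw [scfConj_pow, ← hT, hW]
      apply scf_ext <;> simp [scfConj]
  have hpair : ∀ i j, scfB B ((T ^ i) v) ((T ^ j) v) = if i + j = M then 2 * Complex.I else 0 := by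
    intro i j
    rw [← scf_pow_sa (scfB B) T saT, ← Module.End.mul_apply, ← pow_add, hvi, add_comm]
  have hrr : ∀ i j, B (scfRe ((T ^ i) v)) (scfRe ((T ^ j) v)) = 0 := by
    intro i j
    have h1 := congrArg Complex.re (horth i j)
    have h2 := congrArg Complex.re (hpair i j)
    simp only [scfB_re, scfConj, scfRe_mk, scfIm_mk, map_neg, Complex.zero_re] at h1 h2
    have h3 : (if i + j = M then 2 * Complex.I else 0 : ℂ).re = 0 := by split_ifs <;> simp
    linarith
  have hii : ∀ i j, B (scfIm ((T ^ i) v)) (scfIm ((T ^ j) v)) = 0 := by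
    intro i j
    have h1 := congrArg Complex.re (horth i j)
    simp only [scfB_re, scfConj, scfRe_mk, scfIm_mk, map_neg, Complex.zero_re] at h1
    linarith [hrr i j]
  have hri : ∀ i j, B (scfRe ((T ^ i) v)) (scfIm ((T ^ j) v)) = if i + j = M then 1 else 0 := by
    intro i j
    have h1 := congrArg Complex.im (horth i j)
    have h2 := congrArg Complex.im (hpair i j)
    simp only [scfB_im, scfConj, scfRe_mk, scfIm_mk, map_neg, Complex.zero_im] at h1 h2
    split_ifs at h2 ⊢ <;> simp at h2 <;> linarith
  have hir : ∀ i j, B (scfIm ((T ^ i) v)) (scfRe ((T ^ j) v)) = if i + j = M then 1 else 0 := by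
    intro i j
    rw [symm, hri, add_comm]
  have hLT : ∀ i, scfL L ((T ^ i) v) = l • (T ^ i) v + (T ^ (i+1)) v := by
    intro i
    rw [pow_succ', Module.End.mul_apply]
    generalize (T ^ i) v = z
    simp [hT, Module.algebraMap_end_apply]
  have hLr : ∀ i, L (scfRe ((T ^ i) v)) = l.re • scfRe ((T ^ i) v) - l.im • scfIm ((T ^ i) v)
      + scfRe ((T ^ (i+1)) v) := by
    intro i
    rw [← scfRe_L, hLT]; simp
  have hLi : ∀ i, L (scfIm ((T ^ i) v)) = l.re • scfIm ((T ^ i) v) + l.im • scfRe ((T ^ i) v)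
      + scfIm ((T ^ (i+1)) v) := by
    intro i
    rw [← scfIm_L, hLT]; simp
  set f : ℕ → (Fin n → ℝ) := fun j => if j % 2 = 0 then scfRe ((T ^ (M - j/2)) v)
    else scfIm ((T ^ (M - j/2)) v) with hf
  refine ⟨⟨2 * (M+1), true, l.re, -l.im, 1⟩, fun j => f j, ?_, by simp, ?_, ?_⟩
  · simp [ScfBlk.OK, him]
  · intro j
    change Fin (2 * (M+1)) at j
    obtain ⟨j, hj⟩ := j
    simp only [ScfBlk.C, if_true]
    have e : ∀ i : Fin (2 * (M+1)), cJordanBlk (2 * (M+1)) l.re (-l.im) i ⟨j, hj⟩ • f i =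
        (fun i : ℕ => (if i = j then l.re • f i else 0)
        + (if j = i + 1 ∧ i % 2 = 0 then l.im • f i else 0)
        + (if i = j + 1 ∧ j % 2 = 0 then (-l.im) • f i else 0)
        + (if j = i + 2 then f i else 0)) (i : ℕ) := by
      rintro ⟨i, hi⟩
      simp only [cJordanBlk, Fin.mk.injEq, neg_neg]
      split_ifs <;> first | omega | simp
    rw [Finset.sum_congr rfl (fun i _ => e i), Fin.sum_univ_eq_sum_range (fun i : ℕ =>
        (if i = j then l.re • f i else 0)
        + (if j = i + 1 ∧ i % 2 = 0 then l.im • f i else 0)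
        + (if i = j + 1 ∧ j % 2 = 0 then (-l.im) • f i else 0)
        + (if j = i + 2 then f i else 0)), Finset.sum_add_distrib, Finset.sum_add_distrib,
      Finset.sum_add_distrib]
    rw [scf_sum_one _ j _ (fun i => i = j) hj (by simp)]
    have hz : (T ^ (M+1)) v = 0 := hv
    have h4 : (∑ i ∈ Finset.range (2 * (M+1)), if j = i + 2 then f i else 0) =
        if j % 2 = 0 then scfRe ((T ^ (M - j/2 + 1)) v) else scfIm ((T ^ (M - j/2 + 1)) v) := by
      by_cases h : j < 2
      · rw [Finset.sum_eq_zero]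
        · have : j / 2 = 0 := by omega
          simp [this, hz]
        · intro i _; rw [if_neg (by omega)]
      · rw [scf_sum_one _ (j-2) _ (fun i => j = i + 2) (by omega) (by intro i; omega)]
        have e1 : (j - 2) % 2 = j % 2 := by omega
        have e2 : M - (j-2)/2 = M - j/2 + 1 := by omega
        simp only [hf, e1, e2]
    rw [h4]
    by_cases hp : j % 2 = 0
    · rw [scf_sum_one _ (j+1) _ (fun i => i = j + 1 ∧ j % 2 = 0) (by omega) (by intro i; omega),
        Finset.sum_eq_zero (f := fun i => if j = i + 1 ∧ i % 2 = 0 then l.im • f i else 0)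
          (by intro i _; rw [if_neg (by omega)])]
      have e1 : (j + 1) / 2 = j / 2 := by omega
      have e2 : ¬ ((j + 1) % 2 = 0) := by omega
      simp only [hf, if_pos hp, if_neg e2, e1, hLr]
      rw [neg_smul]; abel
    · rw [scf_sum_one _ (j-1) _ (fun i => j = i + 1 ∧ i % 2 = 0) (by omega) (by intro i; omega),
        Finset.sum_eq_zero (f := fun i => if i = j + 1 ∧ j % 2 = 0 then (-l.im) • f i else 0)
          (by intro i _; rw [if_neg (by omega)])]
      have e1 : (j - 1) / 2 = j / 2 := by omega
      have e2 : (j - 1) % 2 = 0 := by omega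
      simp only [hf, if_neg hp, if_pos e2, e1, hLi]
      abel
  · rintro ⟨i, hi⟩ ⟨j, hj⟩
    change i < 2 * (M+1) at hi
    change j < 2 * (M+1) at hj
    simp only [antiDiagBlk, hf]
    by_cases h1 : i % 2 = 0 <;> by_cases h2 : j % 2 = 0 <;>
      simp only [h1, h2, if_true, if_false, hrr, hri, hir, hii]
    · rw [if_neg (by omega)]
    · congr 1; simp; omega
    · congr 1; simp; omega
    · rw [if_neg (by omega)]

lemma scf_key_fin (hn : 0 < n) (B : (Fin n → ℝ) →ₗ[ℝ] (Fin n → ℝ) →ₗ[ℝ] ℝ)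
    (L : Module.End ℝ (Fin n → ℝ))
    (symm : ∀ x y, B x y = B y x) (nd : ∀ x, (∀ y, B x y = 0) → x = 0)
    (sa : ∀ x y, B (L x) y = B x (L y)) :
    ∃ (d : ScfBlk) (w : Fin d.s → (Fin n → ℝ)), d.OK ∧ 0 < d.s ∧ ScfReal B L d w := by
  have : NeZero n := ⟨hn.ne'⟩
  obtain ⟨l, hl⟩ := Module.End.exists_eigenvalue (scfL L)
  by_cases him : l.im = 0
  · apply scf_key_real B L symm nd sa l.re
    obtain ⟨u, hu⟩ := hl.exists_hasEigenvector
    have h := hu.apply_eq_smul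
    have h1 := congrArg scfRe h
    have h2 := congrArg scfIm h
    simp [him] at h1 h2
    by_cases h0 : scfRe u = 0
    · refine Module.End.hasEigenvalue_of_hasEigenvector (x := scfIm u)
        ⟨Module.End.mem_eigenspace_iff.2 h2, fun h3 => hu.2 (scf_ext h0 h3)⟩
    · exact Module.End.hasEigenvalue_of_hasEigenvector (x := scfRe u)
        ⟨Module.End.mem_eigenspace_iff.2 h1, h0⟩
  · exact scf_key_cplx B L symm nd sa l hl him
end cplx
section glob

lemma scf_key {V : Type*} [AddCommGroup V] [Module ℝ V] [FiniteDimensional ℝ V]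
    (hn : 0 < Module.finrank ℝ V) (B : V →ₗ[ℝ] V →ₗ[ℝ] ℝ) (L : Module.End ℝ V)
    (symm : ∀ x y, B x y = B y x) (nd : ∀ x, (∀ y, B x y = 0) → x = 0)
    (sa : ∀ x y, B (L x) y = B x (L y)) :
    ∃ (d : ScfBlk) (w : Fin d.s → V), d.OK ∧ 0 < d.s ∧ ScfReal B L d w := by
  let φ : V ≃ₗ[ℝ] (Fin (Module.finrank ℝ V) → ℝ) := (Module.finBasis ℝ V).equivFun
  obtain ⟨d, w, h1, h2, h3, h4⟩ := scf_key_fin hn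
    (B.compl₁₂ φ.symm.toLinearMap φ.symm.toLinearMap)
    (φ.toLinearMap ∘ₗ L ∘ₗ φ.symm.toLinearMap)
    (by intro x y; simp [symm (φ.symm x)])
    (by
      intro x hx
      have : φ.symm x = 0 := by
        apply nd
        intro y
        simpa using hx (φ y)
      simpa using this)
    (by intro x y; simp [sa])
  refine ⟨d, fun j => φ.symm (w j), h1, h2, ?_, ?_⟩
  · intro j
    have := congrArg φ.symm (h3 j)
    simpa using this
  · intro i j
    simpa using h4 i j

/-- Duality for the antidiagonal Gram matrix. -/
lemma scf_dual {V : Type*} [AddCommGroup V] [Module ℝ V] (B : V →ₗ[ℝ] V →ₗ[ℝ] ℝ)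
    (d : ScfBlk) (hd : d.OK) (w : Fin d.s → V)
    (hw : ∀ i j, B (w i) (w j) = antiDiagBlk d.s d.ε i j) (c : Fin d.s → ℝ) (j : Fin d.s) :
    B (∑ l, c l • w l) (w (Fin.rev j)) = d.ε * c j := by
  simp only [map_sum, map_smul, LinearMap.sum_apply, LinearMap.smul_apply, hw, smul_eq_mul]
  rw [Finset.sum_eq_single j]
  · simp only [antiDiagBlk, Fin.val_rev]
    rw [if_pos (by omega), mul_comm]
  · intro l _ hl
    simp only [antiDiagBlk, Fin.val_rev]
    rw [if_neg, mul_zero]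
    intro h
    apply hl
    ext
    omega
  · simp

/-- full decomposition -/
lemma scf_decomp (N : ℕ) : ∀ (V : Type) [AddCommGroup V] [Module ℝ V] [FiniteDimensional ℝ V]
    (_ : Module.finrank ℝ V ≤ N) (B : V →ₗ[ℝ] V →ₗ[ℝ] ℝ) (L : Module.End ℝ V)
    (_ : ∀ x y, B x y = B y x) (_ : ∀ x, (∀ y, B x y = 0) → x = 0)
    (_ : ∀ x y, B (L x) y = B x (L y)),
    ∃ (ι : Type) (_ : Fintype ι) (d : ι → ScfBlk) (w : ∀ i, Fin (d i).s → V),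
      (∀ i, (d i).OK ∧ ScfReal B L (d i) (w i)) ∧
      (∀ i i', i ≠ i' → ∀ j j', B (w i j) (w i' j') = 0) ∧
      (∀ x, x ∈ Submodule.span ℝ (Set.range (fun p : (i : ι) × Fin (d i).s => w p.1 p.2))) := by
  induction N with
  | zero =>
    intro V _ _ _ hN B L symm nd sa
    refine ⟨Empty, inferInstance, fun i => i.elim, fun i => i.elim, fun i => i.elim,
      fun i => i.elim, ?_⟩
    have := Module.finrank_zero_iff.1 (Nat.le_zero.1 hN)
    intro x
    rw [Subsingleton.elim x 0]
    exact Submodule.zero_mem _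
  | succ N ih =>
    intro V _ _ _ hN B L symm nd sa
    rcases Nat.eq_zero_or_pos (Module.finrank ℝ V) with h0 | hpos
    · refine ⟨Empty, inferInstance, fun i => i.elim, fun i => i.elim, fun i => i.elim,
        fun i => i.elim, ?_⟩
      have := Module.finrank_zero_iff.1 h0
      intro x
      rw [Subsingleton.elim x 0]
      exact Submodule.zero_mem _
    obtain ⟨d, w, hd, hs, hwL, hwB⟩ := scf_key hpos B L symm nd sa
    let U : Submodule ℝ V :=
      { carrier := {x | ∀ j, B x (w j) = 0}
        add_mem' := by intro x y hx hy j; simp [hx j, hy j]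
        zero_mem' := by intro j; simp
        smul_mem' := by intro c x hx j; simp [hx j] }
    have hU : ∀ x, x ∈ U ↔ ∀ j, B x (w j) = 0 := fun x => Iff.rfl
    -- projection
    have hproj : ∀ x, ∃ c : Fin d.s → ℝ, x - ∑ l, c l • w l ∈ U := by
      intro x
      refine ⟨fun j => d.ε * B x (w (Fin.rev j)), ?_⟩
      rw [hU]
      intro j
      obtain ⟨j, rfl⟩ := Fin.rev_surjective j
      rw [map_sub, LinearMap.sub_apply, scf_dual B d hd w hwB, ← mul_assoc, hd.sq, one_mul,
        sub_self]
    have hUw : ∀ x ∈ U, ∀ c : Fin d.s → ℝ, B x (∑ l, c l • w l) = 0 := by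
      intro x hx c
      simp [map_sum, (hU x).1 hx]
    have hUL : ∀ x ∈ U, L x ∈ U := by
      intro x hx
      rw [hU]
      intro j
      rw [sa, hwL]
      exact hUw x hx _
    have hlt : Module.finrank ℝ U < Module.finrank ℝ V := by
      apply Submodule.finrank_lt
      intro htop
      have h1 : w (⟨0, hs⟩) ∈ U := htop ▸ Submodule.mem_top
      have h2 := (hU _).1 h1 ⟨d.s - 1, by omega⟩
      rw [hwB] at h2
      simp only [antiDiagBlk] at h2
      rw [if_pos (by omega)] at h2
      have := hd.sq
      rw [h2] at this
      simp at this
    obtain ⟨ι, _, d', w', h1, h2, h3⟩ := ih U (by omega)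
      (B.compl₁₂ U.subtype U.subtype) (L.restrict hUL)
      (by intro x y; simp [symm (x : V)])
      (by
        intro x hx
        apply Subtype.ext
        apply nd
        intro y
        obtain ⟨c, hc⟩ := hproj y
        have e : y = (y - ∑ l, c l • w l) + ∑ l, c l • w l := by simp
        rw [e, map_add, hUw x x.2, add_zero]
        exact hx ⟨_, hc⟩)
      (by intro x y; simp [sa])
    refine ⟨Option ι, inferInstance, fun o => o.elim d d',
      fun o => match o with
        | none => w
        | some i => fun j => (w' i j : V), ?_, ?_, ?_⟩
    · rintro (_ | i)
      · exact ⟨hd, hwL, hwB⟩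
      · refine ⟨(h1 i).1, ?_, ?_⟩
        · intro j
          have := congrArg (U.subtype) ((h1 i).2.1 j)
          simp only [map_sum, map_smul, Submodule.subtype_apply, LinearMap.restrict_coe_apply] at this
          exact this
        · intro j j'
          exact (h1 i).2.2 j j'
    · rintro (_ | i) (_ | i') hne j j'
      · exact absurd rfl hne
      · change B (w j) (w' i' j') = 0
        rw [symm]
        exact (hU _).1 (w' i' j').2 j
      · exact (hU _).1 (w' i j).2 j'
      · exact h2 i i' (fun h => hne (by rw [h])) j j'
    · intro x
      obtain ⟨c, hc⟩ := hproj x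
      have e : x = (x - ∑ l, c l • w l) + ∑ l, c l • w l := by simp
      rw [e]
      refine Submodule.add_mem _ ?_ ?_
      · have h4 := Submodule.mem_map_of_mem (f := U.subtype) (h3 ⟨_, hc⟩)
        rw [Submodule.map_span] at h4
        refine Submodule.span_mono ?_ h4
        rintro _ ⟨_, ⟨⟨i, j⟩, rfl⟩, rfl⟩
        exact ⟨⟨some i, j⟩, rfl⟩
      · refine Submodule.sum_mem _ fun l _ => Submodule.smul_mem _ _ (Submodule.subset_span ?_)
        exact ⟨⟨none, l⟩, rfl⟩
end glob

/-- simultaneous canonical form of a nondegenerate symmetric bilinear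
form and a selfadjoint operator. -/
theorem simultaneous_canonical_form
    (n : ℕ) (G L : Matrix (Fin n) (Fin n) ℝ)
    (hGsymm : G.IsSymm) (hGinv : IsUnit G.det)
    (hsa : Lᵀ * G = G * L) :
    ∃ (k : ℕ) (s : Fin k → ℕ) (e : ((i : Fin k) × Fin (s i)) ≃ Fin n)
      (P : Matrix (Fin n) (Fin n) ℝ) (_ : IsUnit P.det)
      (isC : Fin k → Bool) (a b ε : Fin k → ℝ),
      (∀ i : Fin k, if isC i then (Even (s i) ∧ b i ≠ 0 ∧ ε i = 1)
        else (ε i = 1 ∨ ε i = -1)) ∧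
      P⁻¹ * L * P = (Matrix.blockDiagonal'
        (fun i => if isC i then cJordanBlk (s i) (a i) (b i)
          else rJordanBlk (s i) (a i))).submatrix e.symm e.symm ∧
      Pᵀ * G * P = (Matrix.blockDiagonal'
        (fun i => antiDiagBlk (s i) (ε i))).submatrix e.symm e.symm := by
  classical
  obtain ⟨ι, _, d', w', h1', h2', h3'⟩ := scf_decomp n (Fin n → ℝ) (by simp)
    (Matrix.toLinearMap₂' ℝ G) (Matrix.toLin' L)
    (by
      intro x y
      rw [Matrix.toLinearMap₂'_apply', Matrix.toLinearMap₂'_apply', Matrix.dotProduct_mulVec,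
        ← Matrix.mulVec_transpose, hGsymm.eq, dotProduct_comm])
    (by
      intro x hx
      have h : G *ᵥ x = 0 := by
        apply dotProduct_eq_zero
        intro y
        have := hx y
        rwa [Matrix.toLinearMap₂'_apply', Matrix.dotProduct_mulVec,
          ← Matrix.mulVec_transpose, hGsymm.eq] at this
      exact Matrix.eq_zero_of_mulVec_eq_zero hGinv.ne_zero h)
    (by
      intro x y
      simp only [Matrix.toLinearMap₂'_apply', Matrix.toLin'_apply]
      rw [Matrix.mulVec_mulVec, ← hsa, ← Matrix.mulVec_mulVec, Matrix.dotProduct_mulVec x,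
        Matrix.vecMul_transpose])
  -- reindex by Fin k
  let σ : Fin (Fintype.card ι) ≃ ι := (Fintype.equivFin ι).symm
  obtain ⟨k, d, w, hOK, hL, hB, hB2, hspan⟩ : ∃ (k : ℕ) (d : Fin k → ScfBlk)
      (w : ∀ i, Fin (d i).s → (Fin n → ℝ)), (∀ i, (d i).OK) ∧
      (∀ i j, Matrix.toLin' L (w i j) = ∑ l, (d i).C l j • w i l) ∧
      (∀ i j j', Matrix.toLinearMap₂' ℝ G (w i j) (w i j') = antiDiagBlk (d i).s (d i).ε j j') ∧
      (∀ i i', i ≠ i' → ∀ j j', Matrix.toLinearMap₂' ℝ G (w i j) (w i' j') = 0) ∧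
      (∀ x, x ∈ Submodule.span ℝ (Set.range
        (fun p : (i : Fin k) × Fin (d i).s => w p.1 p.2))) := by
    refine ⟨Fintype.card ι, fun i => d' (σ i), fun i => w' (σ i), fun i => (h1' _).1,
      fun i => (h1' _).2.1, fun i => (h1' _).2.2,
      fun i i' h => h2' _ _ (fun h' => h (σ.injective h')), fun x => ?_⟩
    refine Submodule.span_mono ?_ (h3' x)
    rintro _ ⟨⟨i, j⟩, rfl⟩
    obtain ⟨i, rfl⟩ := σ.surjective i
    exact ⟨⟨i, j⟩, rfl⟩
  let u : ((i : Fin k) × Fin (d i).s) → (Fin n → ℝ) := fun p => w p.1 p.2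
  have hli : LinearIndependent ℝ u := by
    rw [Fintype.linearIndependent_iff]
    rintro g hg ⟨i, j⟩
    have h1 : Matrix.toLinearMap₂' ℝ G (∑ p, g p • u p) (w i (Fin.rev j)) = 0 := by
      rw [hg]; simp
    rw [Fintype.sum_sigma, map_sum, LinearMap.sum_apply, Finset.sum_eq_single i] at h1
    · rw [scf_dual _ (d i) (hOK i) (w i) (hB i) (fun l => g ⟨i, l⟩)] at h1
      have h2 := (hOK i).sq
      rcases mul_eq_zero.1 h1 with h | h
      · rw [h] at h2; simp at h2
      · exact h
    · intro i' _ hne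
      simp only [map_sum, map_smul, LinearMap.sum_apply, LinearMap.smul_apply, u]
      exact Finset.sum_eq_zero fun l _ => by rw [hB2 i' i hne, smul_zero]
    · simp
  let bas := Module.Basis.mk hli (fun x _ => hspan x)
  have hcard : Fintype.card ((i : Fin k) × Fin (d i).s) = Fintype.card (Fin n) := by
    rw [← Module.finrank_eq_card_basis bas]; simp
  let e : ((i : Fin k) × Fin (d i).s) ≃ Fin n := Fintype.equivOfCardEq hcard
  let Q : Matrix (Fin n) ((i : Fin k) × Fin (d i).s) ℝ := Matrix.of fun r p => u p r
  let P : Matrix (Fin n) (Fin n) ℝ := Q.submatrix id e.symm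
  have hGram : Pᵀ * G * P = (Matrix.blockDiagonal'
        (fun i => antiDiagBlk (d i).s (d i).ε)).submatrix e.symm e.symm := by
    ext r c
    rw [Matrix.submatrix_apply]
    generalize hp : e.symm r = p
    generalize hq : e.symm c = q
    have h1 : (Pᵀ * G * P) r c = Matrix.toLinearMap₂' ℝ G (u p) (u q) := by
      rw [Matrix.toLinearMap₂'_apply', Matrix.dotProduct_mulVec, ← hp, ← hq]
      rfl
    rw [h1]
    obtain ⟨i, j⟩ := p
    obtain ⟨i', j'⟩ := q
    by_cases h : i = i'
    · subst h
      rw [Matrix.blockDiagonal'_apply_eq]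
      exact hB i j j'
    · rw [Matrix.blockDiagonal'_apply_ne _ _ _ h]
      exact hB2 i i' h j j'
  have hPdet : IsUnit P.det := by
    have hc : LinearIndependent ℝ P.col := by
      have : P.col = u ∘ e.symm := by
        funext c; rfl
      rw [this]
      exact hli.comp _ e.symm.injective
    exact (Matrix.isUnit_iff_isUnit_det _).1 (Matrix.linearIndependent_cols_iff_isUnit.1 hc)
  refine ⟨k, fun i => (d i).s, e, P, hPdet, fun i => (d i).isC, fun i => (d i).a,
    fun i => (d i).b, fun i => (d i).ε, hOK, ?_, hGram⟩
  change P⁻¹ * L * P = (Matrix.blockDiagonal' (fun i => (d i).C)).submatrix e.symm e.symm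
  have hLP : L * P = P * (Matrix.blockDiagonal' (fun i => (d i).C)).submatrix e.symm e.symm := by
    have hLQ : L * Q = Q * Matrix.blockDiagonal' (fun i => (d i).C) := by
      ext r ⟨i, j⟩
      have h := congrFun (hL i j) r
      have h1 : (L * Q) r ⟨i, j⟩ = Matrix.toLin' L (w i j) r := rfl
      rw [h1, h, Matrix.mul_apply, Fintype.sum_sigma, Finset.sum_eq_single i]
      · simp only [Matrix.blockDiagonal'_apply_eq, Finset.sum_apply, Pi.smul_apply, smul_eq_mul]
        exact Finset.sum_congr rfl fun l _ => mul_comm _ _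
      · intro i' _ hne
        exact Finset.sum_eq_zero fun l _ => by
          rw [Matrix.blockDiagonal'_apply_ne _ _ _ hne, mul_zero]
      · simp
    calc L * P = (L * Q).submatrix id e.symm := rfl
      _ = (Q * Matrix.blockDiagonal' (fun i => (d i).C)).submatrix id e.symm := by rw [hLQ]
      _ = _ := by rw [← Matrix.submatrix_mul_equiv _ _ _ e.symm]
  rw [Matrix.mul_assoc, hLP, ← Matrix.mul_assoc, Matrix.nonsing_inv_mul _ hPdet, Matrix.one_mul]
end
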